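/- arXiv:1201.5575 — 14 statements merged into one kernel-verified Lean document; each statement's English description precedes it below -/
import Mathlib

section
/- Let s ≥ 1 be an integer, b_1,…,b_s ≥ 1 natural numbers, and d_{ij} ∈ ℕ for 1 ≤ i ≤ s, 1 ≤ j ≤ b_i. Suppose there exists a polynomial Q ∈ ℚ[X] such that 1 + Σ_{i=1}^{s} (−1)^i Σ_{j=1}^{b_i} X^{d_{ij}} = Q(X)·(1−X)^s in ℚ[X]. Then: (a) Σ_{i=1}^{s} (−1)^i b_i = −1; (b) for every integer r with 1 ≤ r ≤ s−1, Σ_{i=1}^{s} (−1)^i Σ_{j=1}^{b_i} d_{ij}^r = 0; and (c) Σ_{i=1}^{s} (−1)^i Σ_{j=1}^{b_i} d_{ij}^s = (−1)^s · s! · Q(1). -/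
open Polynomial Finset

/-- The Euler operator `p ↦ X * derivative p` on polynomials. -/
noncomputable def eulerOp : ℚ[X] →ₗ[ℚ] ℚ[X] :=
  LinearMap.mulLeft ℚ (X : ℚ[X]) ∘ₗ derivative

theorem eulerOp_apply (p : ℚ[X]) : eulerOp p = X * derivative p := rfl

theorem eulerOp_pow_X_pow (r n : ℕ) :
    (eulerOp ^ r) ((X : ℚ[X]) ^ n) = (n : ℚ) ^ r • (X : ℚ[X]) ^ n := by
  induction r with
  | zero => simp
  | succ r ih =>
    have h : eulerOp ((X : ℚ[X]) ^ n) = (n : ℚ) • (X : ℚ[X]) ^ n := by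
      cases n with
      | zero => simp [eulerOp_apply]
      | succ n =>
        rw [eulerOp_apply, derivative_X_pow_succ, smul_eq_C_mul]
        push_cast
        ring
    rw [pow_succ, Module.End.mul_apply, h, map_smul, ih, smul_smul, pow_succ']

theorem exists_eulerOp_pow_mul_one_sub_X_pow (r k : ℕ) (Q : ℚ[X]) :
    ∃ P : ℚ[X], (eulerOp ^ r) (Q * (1 - X) ^ (k + r)) = P * (1 - X) ^ k ∧
      P.eval 1 = (-1) ^ r * ((k + r).descFactorial r : ℚ) * Q.eval 1 := by
  induction r generalizing Q with
  | zero => exact ⟨Q, by simp, by simp⟩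
  | succ r ih =>
    obtain ⟨P, hP, hP1⟩ := ih (X * derivative Q * (1 - X) - C ((k + r + 1 : ℕ) : ℚ) * X * Q)
    refine ⟨P, ?_, ?_⟩
    · rw [pow_succ, Module.End.mul_apply, ← hP, eulerOp_apply, ← add_assoc, derivative_mul,
        derivative_pow_succ]
      congr 1
      simp only [derivative_sub, derivative_one, derivative_X]
      push_cast
      simp only [map_add, map_one, map_natCast]
      ring
    · rw [hP1, ← add_assoc, Nat.succ_descFactorial_succ]
      simp only [eval_sub, eval_mul, eval_X, eval_one, eval_C]
      push_cast
      ring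

/-- Peskine–Szpiro equations: if `1 + Σ_{i=1}^s (-1)^i Σ_{j=1}^{b_i} X^{d ij} = Q·(1-X)^s`
then the alternating power sums of the shifts vanish below degree `s`, give `-1` in degree `0`,
and give `(-1)^s s! Q(1)` in degree `s`. -/
theorem stmt_0 (s : ℕ) (hs : 1 ≤ s) (b : ℕ → ℕ) (hb : ∀ i ∈ Finset.Icc 1 s, 1 ≤ b i)
    (d : ℕ → ℕ → ℕ) (Q : ℚ[X])
    (hQ : (1 : ℚ[X]) + ∑ i ∈ Finset.Icc 1 s, (-1 : ℚ[X]) ^ i *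
        ∑ j ∈ Finset.Icc 1 (b i), (X : ℚ[X]) ^ (d i j) = Q * (1 - X) ^ s) :
    (∑ i ∈ Finset.Icc 1 s, (-1 : ℚ) ^ i * (b i : ℚ) = -1) ∧
    (∀ r : ℕ, 1 ≤ r → r ≤ s - 1 →
      ∑ i ∈ Finset.Icc 1 s, (-1 : ℚ) ^ i *
        ∑ j ∈ Finset.Icc 1 (b i), (d i j : ℚ) ^ r = 0) ∧
    (∑ i ∈ Finset.Icc 1 s, (-1 : ℚ) ^ i * ∑ j ∈ Finset.Icc 1 (b i), (d i j : ℚ) ^ s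
      = (-1 : ℚ) ^ s * (s.factorial : ℚ) * Q.eval 1) := by
  have key (r : ℕ) : (0 : ℚ) ^ r + ∑ i ∈ Finset.Icc 1 s, (-1 : ℚ) ^ i *
      ∑ j ∈ Finset.Icc 1 (b i), (d i j : ℚ) ^ r
      = ((eulerOp ^ r) (Q * (1 - X) ^ s)).eval 1 := by
    have hneg (i : ℕ) (p : ℚ[X]) : (-1 : ℚ[X]) ^ i * p = (-1 : ℚ) ^ i • p := by
      simp [smul_eq_C_mul]
    have hone : (eulerOp ^ r) (1 : ℚ[X]) = (0 : ℚ) ^ r • 1 := by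
      simpa using eulerOp_pow_X_pow r 0
    rw [← hQ]
    simp only [hneg, map_add, map_sum, map_smul, hone, eulerOp_pow_X_pow, eval_add,
      eval_finsetSum, eval_smul, eval_pow, eval_X, eval_one, one_pow, smul_eq_mul, mul_one]
  have hlt (r : ℕ) (hr : r < s) : ((eulerOp ^ r) (Q * (1 - X) ^ s)).eval 1 = 0 := by
    obtain ⟨P, hP, -⟩ := exists_eulerOp_pow_mul_one_sub_X_pow r (s - r) Q
    rw [Nat.sub_add_cancel hr.le] at hP
    simp [hP, Nat.sub_ne_zero_of_lt hr]
  refine ⟨?_, fun r hr hrs => ?_, ?_⟩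
  · have h := key 0
    rw [hlt 0 hs] at h
    simp only [pow_zero, sum_const, Nat.card_Icc, Nat.add_sub_cancel, nsmul_eq_mul, mul_one] at h
    linarith
  · have h := key r
    rwa [hlt r (by omega), zero_pow (by omega), zero_add] at h
  · have h := key s
    obtain ⟨P, hP, hP1⟩ := exists_eulerOp_pow_mul_one_sub_X_pow s 0 Q
    rw [zero_add] at hP hP1
    rwa [hP, pow_zero, mul_one, hP1, Nat.descFactorial_self, zero_pow (by omega), zero_add] at h
end

section
/- Let s ≥ 1 and l ≥ 0 be integers, b_1,…,b_s ≥ 1 natural numbers, and d_{ij} ∈ ℕ for 1 ≤ i ≤ s, 1 ≤ j ≤ b_i. Suppose there exists a polynomial Q ∈ ℚ[X] such that 1 + Σ_{i=1}^{s} (−1)^i Σ_{j=1}^{b_i} X^{d_{ij}} = Q(X)·(1−X)^s in ℚ[X]. Define e_l = Q^{(l)}(1)/l! (the l-th derivative of Q evaluated at 1, divided by l!) and ν_j = e_j(1, 2, …, s+l−1). Then (−1)^s (s+l)! e_l = Σ_{r=0}^{l} (−1)^{l−r} ν_{l−r} · Σ_{i=1}^{s} (−1)^i Σ_{j=1}^{b_i}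 d_{ij}^{s+r}. -/
open Polynomial Finset

/-- The falling factorial expanded in powers of its argument. -/
theorem factorial_mul_choose_eq_sum_pow (d n : ℕ) (hn : 1 ≤ n) :
    (n.factorial : ℚ) * (d.choose n : ℚ) = ∑ j ∈ range n, (-1 : ℚ) ^ j *
      (∑ S ∈ powersetCard j (Icc 1 (n - 1)), ∏ x ∈ S, (x : ℚ)) * (d : ℚ) ^ (n - j) := by
  obtain ⟨m, rfl⟩ : ∃ m, n = m + 1 := ⟨n - 1, by omega⟩
  have h : ((m + 1).factorial : ℚ) * (d.choose (m + 1) : ℚ)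
      = d * ∏ x ∈ Icc 1 m, ((d : ℚ) - x) := by
    rw [← Nat.cast_mul, ← Nat.descFactorial_eq_factorial_mul_choose,
      ← descPochhammer_eval_eq_descFactorial, descPochhammer_eval_eq_prod_range,
      prod_range_succ', mul_comm, range_eq_Ico, prod_Ico_add' (fun x : ℕ => (d : ℚ) - x) 0 m 1]
    simp [Finset.Ico_add_one_right_eq_Icc]
  rw [h]
  have h2 : ∏ x ∈ Icc 1 m, ((d : ℚ) - x) = ∏ x ∈ Icc 1 m, (-(x : ℚ) + d) :=
    prod_congr rfl fun x _ => by ring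
  rw [h2, prod_add, sum_powerset, mul_sum, Nat.card_Icc]
  simp only [Nat.add_sub_cancel]
  refine sum_congr rfl fun j hj => ?_
  rw [mul_sum, mul_sum, sum_mul]
  refine sum_congr rfl fun S hS => ?_
  obtain ⟨hS, hc⟩ := mem_powersetCard.1 hS
  have hj' : m + 1 - j = (m - j) + 1 := by have := mem_range.1 hj; omega
  rw [prod_const, card_sdiff_of_subset hS, Nat.card_Icc, hc, prod_neg, hc, hj', Nat.add_sub_cancel]
  ring

/-- The Euler operator `X * d/dX` iterated fewer than `s` times on a multiple of `(1 - X) ^ s`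
gives a polynomial vanishing at `1`. -/
theorem eval_one_iterate_X_mul_derivative {R : Type*} [CommRing R] (k s : ℕ) (hk : k < s)
    (P : R[X]) (hP : (1 - X) ^ s ∣ P) :
    ((fun p : R[X] => X * derivative p)^[k] P).eval 1 = 0 := by
  induction k generalizing s P with
  | zero =>
    obtain ⟨Q, rfl⟩ := hP
    simp [show s ≠ 0 by omega]
  | succ k ih =>
    rw [Function.iterate_succ_apply]
    refine ih (s - 1) (by omega) _ (Dvd.dvd.mul_left ?_ _)
    obtain ⟨Q, rfl⟩ := hP
    rw [derivative_mul, derivative_pow]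
    exact dvd_add ((Dvd.intro_left _ rfl).mul_right _ |>.mul_right _)
      ((pow_dvd_pow _ (Nat.sub_le s 1)).mul_right _)

theorem iterate_X_mul_derivative_eq {R : Type*} [CommRing R] (k : ℕ) :
    (fun p : R[X] => X * derivative p)^[k] =
      ⇑((LinearMap.mulLeft R (X : R[X]) ∘ₗ derivative) ^ k) := by
  rw [Module.End.coe_pow]
  rfl

theorem X_mul_derivative_pow_X_pow {R : Type*} [CommRing R] (k d : ℕ) :
    ((LinearMap.mulLeft R (X : R[X]) ∘ₗ derivative) ^ k) (X ^ d) = (d : R) ^ k • X ^ d := by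
  induction k with
  | zero => simp
  | succ k ih =>
    rw [pow_succ', Module.End.mul_apply, ih, map_smul, pow_succ, mul_smul]
    congr 1
    rcases d with _ | d
    · simp
    · simp [smul_eq_C_mul]; ring

/-- Expression of the `l`-th Hilbert coefficient `e_l = Q^{(l)}(1)/l!` in terms of the
power sums of the shifts:
`(-1)^s (s+l)! e_l = Σ_{r=0}^l (-1)^{l-r} ν_{l-r} Σ_i (-1)^i Σ_j d_{ij}^{s+r}`,
where `ν_j = e_j(1,…,s+l-1)` is an elementary symmetric function. -/
theorem stmt_1 (s l : ℕ) (hs : 1 ≤ s) (b : ℕ → ℕ) (hb : ∀ i ∈ Finset.Icc 1 s, 1 ≤ b i)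
    (d : ℕ → ℕ → ℕ) (Q : ℚ[X])
    (hQ : (1 : ℚ[X]) + ∑ i ∈ Finset.Icc 1 s, (-1 : ℚ[X]) ^ i *
        ∑ j ∈ Finset.Icc 1 (b i), (X : ℚ[X]) ^ (d i j) = Q * (1 - X) ^ s) :
    (-1 : ℚ) ^ s * ((s + l).factorial : ℚ) *
        ((Polynomial.derivative^[l] Q).eval 1 / (l.factorial : ℚ)) =
      ∑ r ∈ Finset.range (l + 1), (-1 : ℚ) ^ (l - r) *
        (∑ S ∈ Finset.powersetCard (l - r) (Finset.Icc 1 (s + l - 1)), ∏ x ∈ S, (x : ℚ)) *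
        ∑ i ∈ Finset.Icc 1 s, (-1 : ℚ) ^ i *
          ∑ j ∈ Finset.Icc 1 (b i), (d i j : ℚ) ^ (s + r) := by
  set p : ℕ → ℚ := fun k => ∑ i ∈ Icc 1 s, (-1 : ℚ) ^ i * ∑ j ∈ Icc 1 (b i), (d i j : ℚ) ^ k
    with hp
  have hlin : ∀ L : ℚ[X] →ₗ[ℚ] ℚ, L (Q * (1 - X) ^ s) =
      L (X ^ 0) + ∑ i ∈ Icc 1 s, (-1 : ℚ) ^ i * ∑ j ∈ Icc 1 (b i), L (X ^ d i j) := by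
    intro L
    rw [← hQ, map_add, map_sum, pow_zero]
    congr 1
    refine sum_congr rfl fun i _ => ?_
    rw [← map_sum, ← smul_eq_mul ((-1 : ℚ) ^ i), ← map_smul, smul_eq_C_mul]
    simp
  have hzero : ∀ k, 1 ≤ k → k < s → p k = 0 := by
    intro k hk hks
    have h := hlin (leval 1 ∘ₗ ((LinearMap.mulLeft ℚ (X : ℚ[X]) ∘ₗ derivative) ^ k))
    simp only [LinearMap.comp_apply, X_mul_derivative_pow_X_pow] at h
    rw [← iterate_X_mul_derivative_eq, leval_apply,
      eval_one_iterate_X_mul_derivative k s hks _ (Dvd.intro_left _ rfl)] at h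
    simpa [leval_apply, show k ≠ 0 by omega, eq_comm, hp] using h
  have hcoeff : (-1 : ℚ) ^ s * ((derivative^[l] Q).eval 1 / (l.factorial : ℚ)) =
      ∑ i ∈ Icc 1 s, (-1 : ℚ) ^ i * ∑ j ∈ Icc 1 (b i), ((d i j).choose (s + l) : ℚ) := by
    have h := hlin (lcoeff ℚ (s + l) ∘ₗ taylor 1)
    have ht : taylor (1 : ℚ) (Q * (1 - X) ^ s) = C ((-1) ^ s) * (taylor 1 Q * X ^ s) := by
      rw [taylor_mul, taylor_pow, map_sub, taylor_one, taylor_X]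
      simp only [C_1, map_pow, map_neg]
      rw [show (1 : ℚ[X]) - (X + 1) = -1 * X by ring, mul_pow]
      ring
    have hX : ∀ m, (taylor (1 : ℚ) (X ^ m)).coeff (s + l) = (m.choose (s + l) : ℚ) := by
      intro m
      rw [taylor_pow, taylor_X, C_1, coeff_X_add_one_pow]
    simp only [LinearMap.comp_apply, lcoeff_apply, hX, ht] at h
    rw [coeff_C_mul, add_comm s l, coeff_mul_X_pow, taylor_coeff,
      Nat.choose_eq_zero_of_lt (by omega : 0 < l + s), Nat.cast_zero, zero_add] at h
    rw [add_comm s l, ← h, ← factorial_smul_hasseDeriv]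
    simp [Nat.factorial_ne_zero]
  have hexp : ((s + l).factorial : ℚ) *
      ∑ i ∈ Icc 1 s, (-1 : ℚ) ^ i * ∑ j ∈ Icc 1 (b i), ((d i j).choose (s + l) : ℚ) =
      ∑ j ∈ range (s + l), (-1 : ℚ) ^ j *
        (∑ S ∈ powersetCard j (Icc 1 (s + l - 1)), ∏ x ∈ S, (x : ℚ)) * p (s + l - j) := by
    simp only [hp, mul_sum (Icc 1 s)]
    rw [sum_comm]
    refine sum_congr rfl fun i _ => ?_
    rw [mul_left_comm, mul_sum]
    simp_rw [factorial_mul_choose_eq_sum_pow _ (s + l) (by omega)]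
    rw [sum_comm, mul_sum]
    refine sum_congr rfl fun k _ => ?_
    rw [← mul_sum]
    ring
  rw [mul_right_comm, hcoeff, mul_comm, hexp, ← sum_range_reflect _ (l + 1)]
  symm
  refine sum_subset_zero_on_sdiff (range_mono (by omega)) (fun j hj => ?_) fun j hj => ?_
  · simp only [mem_sdiff, mem_range] at hj
    rw [hzero _ (by omega) (by omega), mul_zero]
  · have := mem_range.1 hj
    rw [show l - (l + 1 - 1 - j) = j by omega, show s + (l + 1 - 1 - j) = s + l - j by omega]
end

section
/- Let K be a field of characteristic zero, Q ∈ K[X] a polynomial, and s, l ≥ 0 integers. Then the (s+l)-th derivative of the polynomial Q(X)·(1−X)^s, evaluated at X = 1, equals (−1)^s · C(s+l, l) · s! · Q^{(l)}(1), where Q^{(l)} denotes the l-th derivative of Q. -/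
open Polynomial

theorem Polynomial.eval_iterate_derivative_eq_factorial_mul_taylor_coeff {R : Type*} [CommRing R]
    (p : R[X]) (r : R) (k : ℕ) :
    (Polynomial.derivative^[k] p).eval r = (k.factorial : R) * (taylor r p).coeff k := by
  rw [taylor_coeff, ← factorial_smul_hasseDeriv, LinearMap.smul_apply, eval_smul, nsmul_eq_mul]

theorem Polynomial.taylor_one_mul_one_sub_X_pow_coeff {R : Type*} [CommRing R]
    (p : R[X]) (s l : ℕ) :
    (taylor 1 (p * (1 - X) ^ s)).coeff (s + l) = (-1) ^ s * (taylor 1 p).coeff l := by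
  have h : taylor 1 (p * (1 - X) ^ s) = C ((-1) ^ s) * (taylor 1 p * X ^ s) := by
    have hX : taylor (1 : R) (1 - X) = -X := by simp
    rw [taylor_mul, taylor_pow, hX, neg_pow, C_pow, C_neg, C_1]
    ring
  rw [h, coeff_C_mul, add_comm s l, coeff_mul_X_pow]

/-- The `(s+l)`-th formal derivative of `Q(X)·(1-X)^s` at `X = 1` equals
`(-1)^s · C(s+l,l) · s! · Q^{(l)}(1)`. -/
theorem stmt_2 (K : Type*) [Field K] [CharZero K] (Q : K[X]) (s l : ℕ) :
    (Polynomial.derivative^[s + l] (Q * (1 - X) ^ s)).eval 1 =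
      (-1 : K) ^ s * ((s + l).choose l : K) * (s.factorial : K) *
        (Polynomial.derivative^[l] Q).eval 1 := by
  have h : ((s + l).factorial : K) = (s + l).choose l * s.factorial * l.factorial := by
    exact_mod_cast (Nat.add_choose_mul_factorial_mul_factorial s l).symm
  rw [eval_iterate_derivative_eq_factorial_mul_taylor_coeff,
    eval_iterate_derivative_eq_factorial_mul_taylor_coeff,
    taylor_one_mul_one_sub_X_pow_coeff, h]
  ring
end

section
/- Let k ≥ 1, s = 2k+1, let c be a real number, b_1,…,b_k ≥ 1 natural numbers, a_{ij} real numbers for 1 ≤ i ≤ k, 1 ≤ j ≤ b_i, and e a real number. Assume: (i) for every integer r with 1 ≤ r ≤ 2k, Σ_{i=1}^{k} (−1)^i Σ_{j=1}^{b_i} ( a_{ij}^r − (c−a_{ij})^r ) = c^r; and (ii) Σ_{i=1}^{k} (−1)^i Σ_{j=1}^{b_i} ( a_{ij}^{2k+1} − (c−a_{ij})^{2k+1} ) − c^{2k+1} = −(2k+1)!·e. Then Σ_{i=1}^{k} Σ_{j=1}^{b_i} (−1)^i a_{ij}^t (c−a_{ij})^t (c−2a_{ij}) equals: −c when t = 0;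 0 when 1 ≤ t ≤ k−1; and (−1)^k (2k+1)!·e when t = k. -/
open Finset

/-- The defect of a polynomial `p` in the equations `∑ (-1)^i (p(a_{ij}) - p(c - a_{ij})) = p(c) - p(0)`,
as a linear functional of `p`. -/
noncomputable def peskineSzpiroDefect (k : ℕ) (c : ℝ) (b : ℕ → ℕ) (a : ℕ → ℕ → ℝ) :
    Polynomial ℝ →ₗ[ℝ] ℝ :=
  ∑ i ∈ Finset.Icc 1 k, (-1 : ℝ) ^ i • ∑ j ∈ Finset.Icc 1 (b i),
    (Polynomial.leval (a i j) - Polynomial.leval (c - a i j))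
  - (Polynomial.leval c - Polynomial.leval 0)

theorem peskineSzpiroDefect_apply (k : ℕ) (c : ℝ) (b : ℕ → ℕ) (a : ℕ → ℕ → ℝ)
    (p : Polynomial ℝ) :
    peskineSzpiroDefect k c b a p = ∑ i ∈ Finset.Icc 1 k, (-1 : ℝ) ^ i *
      ∑ j ∈ Finset.Icc 1 (b i), (p.eval (a i j) - p.eval (c - a i j))
      - (p.eval c - p.eval 0) := by
  simp [peskineSzpiroDefect, LinearMap.sum_apply, Polynomial.leval]

/-- A linear functional that vanishes on `X ^ r` for `r < n` is determined in degree at most `n`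
by its value on `X ^ n`. -/
theorem Polynomial.linearMap_apply_eq_coeff_mul (D : Polynomial ℝ →ₗ[ℝ] ℝ) (n : ℕ)
    (hD : ∀ r < n, D (Polynomial.X ^ r) = 0) (p : Polynomial ℝ) (hp : p.natDegree ≤ n) :
    D p = p.coeff n * D (Polynomial.X ^ n) := by
  conv_lhs => rw [p.as_sum_range_C_mul_X_pow' (Nat.lt_succ_of_le hp)]
  simp only [map_sum, ← Polynomial.smul_eq_C_mul, map_smul, smul_eq_mul]
  rw [Finset.sum_range_succ, Finset.sum_eq_zero, zero_add]
  intro r hr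
  rw [hD r (Finset.mem_range.mp hr), mul_zero]

theorem natDegree_X_pow_mul_C_sub_X_pow_le (c : ℝ) (t : ℕ) :
    (Polynomial.X ^ (t + 1) * (Polynomial.C c - Polynomial.X) ^ t).natDegree ≤ 2 * t + 1 := by
  have h : (Polynomial.C c - Polynomial.X).natDegree ≤ 1 := by compute_degree
  have h' := Polynomial.natDegree_pow_le_of_le t h
  have hX : (Polynomial.X ^ (t + 1) : Polynomial ℝ).natDegree ≤ t + 1 := by compute_degree
  exact (Polynomial.natDegree_mul_le_of_le hX h').trans (by omega)

theorem coeff_X_pow_mul_C_sub_X_pow (c : ℝ) (t : ℕ) :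
    (Polynomial.X ^ (t + 1) * (Polynomial.C c - Polynomial.X) ^ t).coeff (2 * t + 1)
      = (-1) ^ t := by
  have h : (Polynomial.C c - Polynomial.X).natDegree ≤ 1 := by compute_degree
  have h' := Polynomial.coeff_pow_of_natDegree_le (m := t) h
  rw [show 2 * t + 1 = t * 1 + (t + 1) by ring, Polynomial.coeff_X_pow_mul, h']
  simp

theorem sum_mul_eq_neg_peskineSzpiroDefect (k : ℕ) (c : ℝ) (b : ℕ → ℕ) (a : ℕ → ℕ → ℝ) (t : ℕ) :
    ∑ i ∈ Finset.Icc 1 k, ∑ j ∈ Finset.Icc 1 (b i),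
        (-1 : ℝ) ^ i * a i j ^ t * (c - a i j) ^ t * (c - 2 * a i j)
      = -peskineSzpiroDefect k c b a
          (Polynomial.X ^ (t + 1) * (Polynomial.C c - Polynomial.X) ^ t)
        - c ^ (t + 1) * 0 ^ t := by
  rw [peskineSzpiroDefect_apply]
  simp only [Polynomial.eval_mul, Polynomial.eval_pow, Polynomial.eval_X, Polynomial.eval_sub,
    Polynomial.eval_C, sub_self, sub_sub_cancel, sub_zero, zero_pow t.succ_ne_zero, zero_mul,
    neg_sub, sub_sub_cancel_left, ← Finset.sum_neg_distrib, Finset.mul_sum]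
  refine Finset.sum_congr rfl fun i _ => Finset.sum_congr rfl fun j _ => ?_
  ring

/-- Srinivasan's identities for a Gorenstein algebra of odd grade `s = 2k+1`:
under the Peskine–Szpiro equations for the self-dual shifts `a_{ij}`, `c - a_{ij}`, `c`,
the sums `Σ_{i,j} (-1)^i a_{ij}^t (c-a_{ij})^t (c-2a_{ij})` equal `-c` for `t = 0`,
`0` for `1 ≤ t ≤ k-1`, and `(-1)^k (2k+1)! e` for `t = k`. -/
theorem stmt_4 (k : ℕ) (hk : 1 ≤ k) (c : ℝ) (b : ℕ → ℕ)
    (hb : ∀ i ∈ Finset.Icc 1 k, 1 ≤ b i) (a : ℕ → ℕ → ℝ) (e : ℝ)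
    (h1 : ∀ r : ℕ, 1 ≤ r → r ≤ 2 * k →
      ∑ i ∈ Finset.Icc 1 k, (-1 : ℝ) ^ i *
        ∑ j ∈ Finset.Icc 1 (b i), (a i j ^ r - (c - a i j) ^ r) = c ^ r)
    (h2 : ∑ i ∈ Finset.Icc 1 k, (-1 : ℝ) ^ i *
        ∑ j ∈ Finset.Icc 1 (b i), (a i j ^ (2 * k + 1) - (c - a i j) ^ (2 * k + 1))
        - c ^ (2 * k + 1) = -(((2 * k + 1).factorial : ℝ) * e)) :
    (∑ i ∈ Finset.Icc 1 k, ∑ j ∈ Finset.Icc 1 (b i),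
        (-1 : ℝ) ^ i * a i j ^ 0 * (c - a i j) ^ 0 * (c - 2 * a i j) = -c) ∧
    (∀ t : ℕ, 1 ≤ t → t ≤ k - 1 →
      ∑ i ∈ Finset.Icc 1 k, ∑ j ∈ Finset.Icc 1 (b i),
        (-1 : ℝ) ^ i * a i j ^ t * (c - a i j) ^ t * (c - 2 * a i j) = 0) ∧
    (∑ i ∈ Finset.Icc 1 k, ∑ j ∈ Finset.Icc 1 (b i),
        (-1 : ℝ) ^ i * a i j ^ k * (c - a i j) ^ k * (c - 2 * a i j)
      = (-1 : ℝ) ^ k * ((2 * k + 1).factorial : ℝ) * e) := by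
  have hlow : ∀ r < 2 * k + 1, peskineSzpiroDefect k c b a (Polynomial.X ^ r) = 0 := by
    intro r hr
    rw [peskineSzpiroDefect_apply]
    rcases Nat.eq_zero_or_pos r with rfl | hr0
    · simp
    · simp only [Polynomial.eval_pow, Polynomial.eval_X]
      rw [h1 r hr0 (by omega), zero_pow hr0.ne', sub_zero, sub_self]
  have htop : peskineSzpiroDefect k c b a (Polynomial.X ^ (2 * k + 1))
      = -(((2 * k + 1).factorial : ℝ) * e) := by
    rw [peskineSzpiroDefect_apply, ← h2]
    simp
  have hdefect : ∀ t < k, peskineSzpiroDefect k c b a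
      (Polynomial.X ^ (t + 1) * (Polynomial.C c - Polynomial.X) ^ t) = 0 := by
    intro t ht
    rw [Polynomial.linearMap_apply_eq_coeff_mul _ (2 * t + 1) (fun r hr => hlow r (by omega)) _
      (natDegree_X_pow_mul_C_sub_X_pow_le c t), hlow _ (by omega), mul_zero]
  refine ⟨?_, fun t ht0 ht => ?_, ?_⟩
  · rw [sum_mul_eq_neg_peskineSzpiroDefect, hdefect 0 (by omega)]
    simp
  · rw [sum_mul_eq_neg_peskineSzpiroDefect, hdefect t (by omega), zero_pow (by omega)]
    simp
  · rw [sum_mul_eq_neg_peskineSzpiroDefect, Polynomial.linearMap_apply_eq_coeff_mul _ (2 * k + 1)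
      hlow _ (natDegree_X_pow_mul_C_sub_X_pow_le c k), coeff_X_pow_mul_C_sub_X_pow, htop,
      zero_pow (by omega)]
    ring
end

section
/- Let k ≥ 1, s = 2k, let c be a real number, r_1,…,r_k ≥ 1 natural numbers, a_{ij} real numbers for 1 ≤ i ≤ k, 1 ≤ j ≤ r_i, and e a real number. Assume: (i) for every integer r with 1 ≤ r ≤ 2k−1, Σ_{i=1}^{k} (−1)^i Σ_{j=1}^{r_i} ( a_{ij}^r + (c−a_{ij})^r ) = −c^r; (ii) Σ_{i=1}^{k} (−1)^i r_i = −1; and (iii) c^{2k} + Σ_{i=1}^{k} (−1)^i Σ_{j=1}^{r_i} ( a_{ij}^{2k} + (c−a_{ij})^{2k} ) = (2k)!·e. Then Σ_{i=1}^{k} Σ_{j=1}^{r_i} (−1)^i a_{ij}^t (c−a_{ij})^t equals: −1 when t = 0; 0 when 1 ≤ t ≤ k−1; and (−1)^k ((2k)!/2)·e when t = k. -/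
open Finset

namespace Polynomial

/-- If the first `n - 1` power moments of a weighted family symmetric under `x ↦ c - x` agree with
those of `-δ_c - δ_0`, and the `n`-th one differs by `E`, then polynomials `p` of degree at most
`n` integrate to `-p(c) - p(0)` plus `E` times the coefficient of `X ^ n`. -/
theorem sum_mul_eval_add_eval_sub {R ι : Type*} [CommRing R] (s : Finset ι) (w x : ι → R)
    (c E : R) {n : ℕ} (hn : n ≠ 0) (h0 : ∑ i ∈ s, w i = -1)
    (hlt : ∀ r, 1 ≤ r → r < n → ∑ i ∈ s, w i * (x i ^ r + (c - x i) ^ r) = -c ^ r)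
    (hE : ∑ i ∈ s, w i * (x i ^ n + (c - x i) ^ n) = -c ^ n + E)
    {p : R[X]} (hp : p.natDegree ≤ n) :
    ∑ i ∈ s, w i * (p.eval (x i) + p.eval (c - x i)) =
      -p.eval c - p.eval 0 + p.coeff n * E := by
  have moment : ∀ r ∈ range (n + 1), ∑ i ∈ s, w i * (x i ^ r + (c - x i) ^ r) =
      -c ^ r - 0 ^ r + if r = n then E else 0 := by
    intro r hr
    rcases Nat.eq_zero_or_pos r with rfl | hr0
    · simp only [pow_zero, ← sum_mul, h0, hn.symm, if_false]
      ring
    · rcases (Nat.lt_succ_iff.mp (mem_range.mp hr)).lt_or_eq with h | rfl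
      · simp [hlt r hr0 h, h.ne, hr0.ne']
      · simp [hE, hn]
  have expand := fun y : R => eval_eq_sum_range' (Nat.lt_succ_of_le hp) y
  calc ∑ i ∈ s, w i * (p.eval (x i) + p.eval (c - x i))
      = ∑ i ∈ s, ∑ r ∈ range (n + 1), p.coeff r * (w i * (x i ^ r + (c - x i) ^ r)) := by
        refine sum_congr rfl fun i _ => ?_
        rw [expand, expand, ← sum_add_distrib, mul_sum]
        exact sum_congr rfl fun r _ => by ring
    _ = ∑ r ∈ range (n + 1), p.coeff r * (-c ^ r - 0 ^ r + if r = n then E else 0) := by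
        rw [sum_comm]
        exact sum_congr rfl fun r hr => by rw [← mul_sum, moment r hr]
    _ = -p.eval c - p.eval 0 + p.coeff n * E := by
        rw [expand c, expand 0]
        simp [mul_add, mul_sub, sum_add_distrib, sum_sub_distrib]

theorem natDegree_X_pow_mul_C_sub_X_pow_le {R : Type*} [CommRing R] (c : R) (t : ℕ) :
    (X ^ t * (C c - X) ^ t : R[X]).natDegree ≤ 2 * t := by
  compute_degree
  omega

theorem coeff_X_pow_mul_C_sub_X_pow {R : Type*} [CommRing R] (c : R) (t : ℕ) :
    (X ^ t * (C c - X) ^ t : R[X]).coeff (2 * t) = (-1) ^ t := by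
  rw [two_mul, coeff_X_pow_mul]
  have h : (C c - X : R[X]).natDegree ≤ 1 := by compute_degree
  simpa using coeff_pow_of_natDegree_le (m := t) h

end Polynomial

/-- Srinivasan's identities for a Gorenstein algebra of even grade `s = 2k`:
under the Peskine–Szpiro equations for the self-dual shifts `a_{ij}`, `c - a_{ij}`, `c`,
the sums `Σ_{i,j} (-1)^i a_{ij}^t (c-a_{ij})^t` equal `-1` for `t = 0`,
`0` for `1 ≤ t ≤ k-1`, and `(-1)^k ((2k)!/2) e` for `t = k`. -/
theorem stmt_5 (k : ℕ) (hk : 1 ≤ k) (c : ℝ) (r_ : ℕ → ℕ)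
    (hr : ∀ i ∈ Finset.Icc 1 k, 1 ≤ r_ i) (a : ℕ → ℕ → ℝ) (e : ℝ)
    (h1 : ∀ r : ℕ, 1 ≤ r → r ≤ 2 * k - 1 →
      ∑ i ∈ Finset.Icc 1 k, (-1 : ℝ) ^ i *
        ∑ j ∈ Finset.Icc 1 (r_ i), (a i j ^ r + (c - a i j) ^ r) = -(c ^ r))
    (h2 : ∑ i ∈ Finset.Icc 1 k, (-1 : ℝ) ^ i * (r_ i : ℝ) = -1)
    (h3 : c ^ (2 * k) + ∑ i ∈ Finset.Icc 1 k, (-1 : ℝ) ^ i *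
        ∑ j ∈ Finset.Icc 1 (r_ i), (a i j ^ (2 * k) + (c - a i j) ^ (2 * k))
        = ((2 * k).factorial : ℝ) * e) :
    (∑ i ∈ Finset.Icc 1 k, ∑ j ∈ Finset.Icc 1 (r_ i),
        (-1 : ℝ) ^ i * a i j ^ 0 * (c - a i j) ^ 0 = -1) ∧
    (∀ t : ℕ, 1 ≤ t → t ≤ k - 1 →
      ∑ i ∈ Finset.Icc 1 k, ∑ j ∈ Finset.Icc 1 (r_ i),
        (-1 : ℝ) ^ i * a i j ^ t * (c - a i j) ^ t = 0) ∧
    (∑ i ∈ Finset.Icc 1 k, ∑ j ∈ Finset.Icc 1 (r_ i),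
        (-1 : ℝ) ^ i * a i j ^ k * (c - a i j) ^ k
      = (-1 : ℝ) ^ k * (((2 * k).factorial : ℝ) / 2) * e) := by
  have key : ∀ t, 1 ≤ t → t ≤ k → 2 * ∑ i ∈ Finset.Icc 1 k, ∑ j ∈ Finset.Icc 1 (r_ i),
      (-1 : ℝ) ^ i * a i j ^ t * (c - a i j) ^ t =
      (Polynomial.X ^ t * (Polynomial.C c - Polynomial.X) ^ t : Polynomial ℝ).coeff (2 * k) *
        (((2 * k).factorial : ℝ) * e) := by
    intro t ht htk
    have ht0 : t ≠ 0 := by omega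
    have h := Polynomial.sum_mul_eval_add_eval_sub
      ((Finset.Icc 1 k).sigma fun i => Finset.Icc 1 (r_ i))
      (fun q => (-1 : ℝ) ^ q.1) (fun q => a q.1 q.2) c (((2 * k).factorial : ℝ) * e)
      (n := 2 * k) (by omega)
      (by simpa [sum_sigma, mul_comm] using h2)
      (fun r hr1 hr2 => by simpa [sum_sigma, mul_sum] using h1 r hr1 (by omega))
      (by
        rw [← h3]
        simp [sum_sigma, mul_sum])
      ((Polynomial.natDegree_X_pow_mul_C_sub_X_pow_le c t).trans (by omega))
    simp only [Polynomial.eval_mul, Polynomial.eval_pow, Polynomial.eval_sub, Polynomial.eval_X,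
      Polynomial.eval_C, sub_self, zero_pow ht0, mul_zero, zero_mul, neg_zero, zero_add,
      sum_sigma] at h
    rw [← h, mul_sum]
    refine sum_congr rfl fun i _ => ?_
    rw [mul_sum]
    exact sum_congr rfl fun j _ => by ring
  refine ⟨by simpa [mul_comm] using h2, fun t ht htk => ?_, ?_⟩
  · have h := key t ht (by omega)
    rw [Polynomial.coeff_eq_zero_of_natDegree_lt
      ((Polynomial.natDegree_X_pow_mul_C_sub_X_pow_le c t).trans_lt (by omega))] at h
    linarith
  · have h := key k hk le_rfl
    rw [Polynomial.coeff_X_pow_mul_C_sub_X_pow] at h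
    linarith
end

section
/- Let k ≥ 1, s = 2k+1, c ≥ 1 a natural number, b_1,…,b_k ≥ 1 natural numbers, and a_{ij} natural numbers with 1 ≤ a_{ij} ≤ c for 1 ≤ i ≤ k, 1 ≤ j ≤ b_i. Suppose there exists Q ∈ ℚ[X] with 1 + Σ_{i=1}^{k} (−1)^i Σ_{j=1}^{b_i} ( X^{a_{ij}} − X^{c−a_{ij}} ) − X^c = Q(X)·(1−X)^s in ℚ[X]. Define e_l = Q^{(l)}(1)/l! and ν_j = e_j(1, 2, …, s+l−1). Then for every integer l ≥ 0: (−1)^k (s+l)! e_l = Σ_{r=0}^{l} (−1)^{l−r} ν_{l−r} Σ_{t=0}^{⌊r/2⌋} (−1)^t C(k+r−t, k+t) c^{r−2t} Σ_{i=1}^{k} Σ_{j=1}^{b_i} (−1)^i a_{ij}^{k+t} (c−a_{ij})^{k+t} (c−2a_{ij}). -/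
open Polynomial Finset

/-- The `m`-th power moment `∑ i, coeff i * i ^ m` of a polynomial, computed as the value at `1`
of the `m`-th iterate of the Euler operator `X * d/dX`. -/
noncomputable def powerMoment (m : ℕ) : ℚ[X] →ₗ[ℚ] ℚ :=
  Polynomial.leval 1 ∘ₗ (LinearMap.mulLeft ℚ (X : ℚ[X]) ∘ₗ derivative) ^ m

theorem powerMoment_zero (P : ℚ[X]) : powerMoment 0 P = P.eval 1 := by
  simp [powerMoment]

theorem powerMoment_succ (m : ℕ) (P : ℚ[X]) :
    powerMoment (m + 1) P = powerMoment m (X * derivative P) := by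
  simp [powerMoment, pow_succ]

theorem powerMoment_X_pow (m n : ℕ) : powerMoment m (X ^ n) = (n : ℚ) ^ m := by
  induction m with
  | zero => simp [powerMoment_zero]
  | succ m ih =>
    have h : (X * derivative (X ^ n) : ℚ[X]) = (n : ℚ) • X ^ n := by
      rcases n with _ | n
      · simp
      · rw [derivative_X_pow, smul_eq_C_mul, Nat.add_sub_cancel]
        ring
    rw [powerMoment_succ, h, map_smul, ih, smul_eq_mul, pow_succ']

theorem powerMoment_eq_zero_of_dvd {m s : ℕ} (hms : m < s) {P : ℚ[X]}
    (hP : (1 - X) ^ s ∣ P) : powerMoment m P = 0 := by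
  induction m generalizing s P with
  | zero =>
    obtain ⟨R, rfl⟩ := hP
    simp [powerMoment_zero, Nat.pos_iff_ne_zero.mp hms]
  | succ m ih =>
    obtain ⟨s, rfl⟩ : ∃ s', s = s' + 1 := ⟨s - 1, by omega⟩
    rw [powerMoment_succ]
    refine ih (s := s) (by omega) (Dvd.dvd.mul_left ?_ X)
    obtain ⟨R, rfl⟩ := hP
    refine ⟨-(s + 1 : ℚ[X]) * R + (1 - X) * derivative R, ?_⟩
    simp only [derivative_mul, derivative_pow, derivative_sub, derivative_one, derivative_X,
      Nat.add_sub_cancel]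
    push_cast
    simp only [map_add, map_natCast, map_one]
    ring

theorem descFactorial_eq_sum_powersetCard (a : ℕ) {n : ℕ} (hn : 1 ≤ n) :
    (a.descFactorial n : ℚ) = ∑ j ∈ range n, (-1 : ℚ) ^ j *
      (∑ S ∈ powersetCard j (Icc 1 (n - 1)), ∏ x ∈ S, (x : ℚ)) * (a : ℚ) ^ (n - j) := by
  obtain ⟨n, rfl⟩ : ∃ n', n = n' + 1 := ⟨n - 1, by omega⟩
  have h : (a.descFactorial (n + 1) : ℚ) = a * ∏ x ∈ Icc 1 n, (-(x : ℚ) + a) := by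
    rw [← descPochhammer_eval_eq_descFactorial, descPochhammer_eval_eq_prod_range,
      prod_range_succ', mul_comm, show Icc 1 n = Ico 1 (n + 1) by ext; simp,
      prod_Ico_eq_prod_range, Nat.add_sub_cancel, Nat.cast_zero, sub_zero]
    congr 1
    refine prod_congr rfl fun i _ => ?_
    push_cast
    ring
  rw [h, prod_add, sum_powerset, mul_sum, Nat.card_Icc, Nat.add_sub_cancel]
  refine sum_congr rfl fun j hj => ?_
  rw [mul_sum, mul_sum, sum_mul]
  refine sum_congr rfl fun S hS => ?_
  obtain ⟨hS, hc⟩ := mem_powersetCard.mp hS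
  rw [prod_neg, prod_const, card_sdiff_of_subset hS, Nat.card_Icc, hc, Nat.add_sub_cancel,
    Nat.sub_add_comm (by simpa [Nat.lt_succ_iff] using hj), pow_succ]
  ring

theorem eval_one_iterate_derivative_eq_sum_powerMoment {n : ℕ} (hn : 1 ≤ n) (P : ℚ[X]) :
    (derivative^[n] P).eval 1 = ∑ j ∈ range n, (-1 : ℚ) ^ j *
      (∑ S ∈ powersetCard j (Icc 1 (n - 1)), ∏ x ∈ S, (x : ℚ)) * powerMoment (n - j) P := by
  induction P using Polynomial.induction_on' with
  | add p q hp hq =>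
    simp only [iterate_map_add, eval_add, hp, hq, map_add, mul_add, sum_add_distrib]
  | monomial m r =>
    rw [← C_mul_X_pow_eq_monomial, iterate_derivative_C_mul,
      iterate_derivative_X_pow_eq_natCast_mul]
    simp only [← smul_eq_C_mul, map_smul, powerMoment_X_pow, eval_smul, eval_mul, eval_natCast,
      eval_pow, eval_X, one_pow, mul_one, smul_eq_mul,
      descFactorial_eq_sum_powersetCard m hn, mul_sum]
    exact sum_congr rfl fun j _ => by ring

theorem eval_one_iterate_derivative_mul_one_sub_X_pow (Q : ℚ[X]) (s l : ℕ) :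
    (derivative^[s + l] (Q * (1 - X) ^ s)).eval 1 =
      (-1) ^ s * ((s + l).factorial : ℚ) * ((derivative^[l] Q).eval 1 / (l.factorial : ℚ)) := by
  have key (n : ℕ) (P : ℚ[X]) :
      (derivative^[n] P).eval 1 = (n.factorial : ℚ) * (taylor 1 P).coeff n := by
    rw [taylor_coeff, ← factorial_smul_hasseDeriv]
    simp
  have h : taylor 1 (Q * (1 - X) ^ s) = C ((-1) ^ s) * (taylor 1 Q * X ^ s) := by
    rw [taylor_mul, taylor_pow, map_sub, taylor_X, taylor_one]
    simp only [map_one, map_pow, map_neg]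
    rw [show (1 - (X + 1) : ℚ[X]) = -1 * X by ring, mul_pow]
    ring
  rw [key, key, h, coeff_C_mul, add_comm s l, coeff_mul_X_pow]
  field_simp

/-- The antidiagonal sum on the left is the bivariate Lucas polynomial in `x + y`, `-(x * y)`. -/
theorem sum_antidiagonal_choose_mul_sub {R : Type*} [CommRing R] (x y : R) (n : ℕ) :
    (∑ p ∈ antidiagonal n, (p.1.choose p.2 : R) * (-(x * y)) ^ p.2 * (x + y) ^ (p.1 - p.2)) *
      (y - x) = y ^ (n + 1) - x ^ (n + 1) := by
  induction n using Nat.twoStepInduction with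
  | zero => simp
  | one => simp [Finset.Nat.antidiagonal_succ]; ring
  | more n ih1 ih2 =>
    have h (w z : R) : ∑ p ∈ antidiagonal (n + 2), (p.1.choose p.2 : R) * z ^ p.2 * w ^ (p.1 - p.2)
        = w * ∑ p ∈ antidiagonal (n + 1), (p.1.choose p.2 : R) * z ^ p.2 * w ^ (p.1 - p.2) +
          z * ∑ p ∈ antidiagonal n, (p.1.choose p.2 : R) * z ^ p.2 * w ^ (p.1 - p.2) := by
      rw [Finset.Nat.antidiagonal_succ_succ', Finset.Nat.antidiagonal_succ' (n := n)]
      simp only [sum_cons, sum_map, mul_sum, Function.Embedding.prodMap, mul_add]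
      have hterm (i j : ℕ) : ((i + 1).choose (j + 1) : R) * z ^ (j + 1) * w ^ (i - j) =
          w * ((i.choose (j + 1) : R) * z ^ (j + 1) * w ^ (i - (j + 1))) +
          z * ((i.choose j : R) * z ^ j * w ^ (i - j)) := by
        rw [Nat.choose_succ_succ]
        rcases lt_or_ge j i with hji | hji
        · rw [show i - j = i - (j + 1) + 1 by omega]
          push_cast
          ring
        · rw [Nat.choose_eq_zero_of_lt (by omega : i < j + 1)]
          push_cast
          ring
      simp [hterm, sum_add_distrib]
      ring
    rw [h, add_mul, mul_assoc, mul_assoc, ih1, ih2]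
    ring

theorem sum_range_choose_mul_sub {R : Type*} [CommRing R] (x y : R) (n : ℕ) :
    ∑ q ∈ range (n / 2 + 1), (-1) ^ q * ((n - q).choose q : R) * (x + y) ^ (n - 2 * q) *
      (x ^ q * y ^ q * (y - x)) = y ^ (n + 1) - x ^ (n + 1) := by
  rw [← sum_antidiagonal_choose_mul_sub, sum_mul, Finset.Nat.sum_antidiagonal_eq_sum_range_succ_mk]
  refine Eq.trans ?_ (sum_range_reflect _ _)
  simp only [Nat.succ_eq_add_one, Nat.add_sub_cancel]
  refine (sum_subset (range_subset_range.mpr (by omega)) fun q hq hq' => ?_).trans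
    (sum_congr rfl fun q hq => ?_)
  · rw [mem_range] at hq hq'
    simp [Nat.choose_eq_zero_of_lt (by omega : n - q < q)]
  · rw [mem_range] at hq
    rw [show n - (n - q) = q by omega, show n - q - q = n - 2 * q by omega, neg_pow (x * y), mul_pow]
    ring

/-- Hilbert coefficients of a Gorenstein algebra of odd grade `s = 2k+1` in terms of
the shifts `a_{ij}`, `c - a_{ij}`, `c` of its self-dual resolution. -/
theorem stmt_6 (k : ℕ) (hk : 1 ≤ k) (c : ℕ) (hc : 1 ≤ c) (b : ℕ → ℕ)
    (hb : ∀ i ∈ Finset.Icc 1 k, 1 ≤ b i) (a : ℕ → ℕ → ℕ)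
    (ha : ∀ i ∈ Finset.Icc 1 k, ∀ j ∈ Finset.Icc 1 (b i), 1 ≤ a i j ∧ a i j ≤ c)
    (Q : ℚ[X])
    (hQ : (1 : ℚ[X]) + ∑ i ∈ Finset.Icc 1 k, (-1 : ℚ[X]) ^ i *
        ∑ j ∈ Finset.Icc 1 (b i), ((X : ℚ[X]) ^ (a i j) - X ^ (c - a i j))
        - X ^ c = Q * (1 - X) ^ (2 * k + 1)) (l : ℕ) :
    (-1 : ℚ) ^ k * ((2 * k + 1 + l).factorial : ℚ) *
        ((Polynomial.derivative^[l] Q).eval 1 / (l.factorial : ℚ)) =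
      ∑ r ∈ Finset.range (l + 1), (-1 : ℚ) ^ (l - r) *
        (∑ S ∈ Finset.powersetCard (l - r) (Finset.Icc 1 (2 * k + 1 + l - 1)),
          ∏ x ∈ S, (x : ℚ)) *
        ∑ t ∈ Finset.range (r / 2 + 1), (-1 : ℚ) ^ t *
          ((k + r - t).choose (k + t) : ℚ) * (c : ℚ) ^ (r - 2 * t) *
          ∑ i ∈ Finset.Icc 1 k, ∑ j ∈ Finset.Icc 1 (b i),
            (-1 : ℚ) ^ i * (a i j : ℚ) ^ (k + t) * ((c : ℚ) - (a i j : ℚ)) ^ (k + t) *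
              ((c : ℚ) - 2 * (a i j : ℚ)) := by
  set P : ℚ[X] := Q * (1 - X) ^ (2 * k + 1) with hP
  set T : ℕ → ℚ := fun q => ∑ i ∈ Finset.Icc 1 k, ∑ j ∈ Finset.Icc 1 (b i),
    (-1 : ℚ) ^ i * (a i j : ℚ) ^ q * ((c : ℚ) - (a i j : ℚ)) ^ q *
      ((c : ℚ) - 2 * (a i j : ℚ)) with hT
  let T' : ℕ → ℚ := fun q => T q + if q = 0 then (c : ℚ) else 0
  have hvanish (m : ℕ) (hm : m < 2 * k + 1) : powerMoment m P = 0 :=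
    powerMoment_eq_zero_of_dvd hm (Dvd.intro_left Q rfl)
  have hmoment (n : ℕ) : powerMoment (n + 1) P =
      -∑ q ∈ range (n / 2 + 1), (-1 : ℚ) ^ q * ((n - q).choose q : ℚ) * (c : ℚ) ^ (n - 2 * q) *
        T' q := by
    have h1 : powerMoment (n + 1) (1 : ℚ[X]) = 0 := by
      simpa using powerMoment_X_pow (n + 1) 0
    have h2 : ∑ q ∈ range (n / 2 + 1), (-1 : ℚ) ^ q * ((n - q).choose q : ℚ) *
        (c : ℚ) ^ (n - 2 * q) * (if q = 0 then (c : ℚ) else 0) = (c : ℚ) ^ (n + 1) := by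
      rw [sum_eq_single 0] <;> simp +contextual [pow_succ]
    have h3 (i j : ℕ) (hi : i ∈ Finset.Icc 1 k) (hj : j ∈ Finset.Icc 1 (b i)) :
        powerMoment (n + 1) (X ^ a i j - X ^ (c - a i j)) =
          -∑ q ∈ range (n / 2 + 1), (-1 : ℚ) ^ q * ((n - q).choose q : ℚ) *
            (c : ℚ) ^ (n - 2 * q) * ((a i j : ℚ) ^ q * ((c : ℚ) - (a i j : ℚ)) ^ q *
              ((c : ℚ) - 2 * (a i j : ℚ))) := by
      have h := sum_range_choose_mul_sub (a i j : ℚ) ((c : ℚ) - a i j) n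
      rw [add_sub_cancel, sub_sub, ← two_mul] at h
      rw [h, map_sub, powerMoment_X_pow, powerMoment_X_pow, Nat.cast_sub (ha i hi j hj).2, neg_sub]
    have h4 (i : ℕ) (R : ℚ[X]) :
        powerMoment (n + 1) ((-1) ^ i * R) = (-1) ^ i * powerMoment (n + 1) R := by
      rw [← smul_eq_mul (a := (-1 : ℚ) ^ i), ← map_smul, smul_eq_C_mul]
      simp
    have h5 : ∑ q ∈ range (n / 2 + 1), (-1 : ℚ) ^ q * ((n - q).choose q : ℚ) *
        (c : ℚ) ^ (n - 2 * q) * T q = -∑ i ∈ Finset.Icc 1 k, (-1 : ℚ) ^ i *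
          ∑ j ∈ Finset.Icc 1 (b i), powerMoment (n + 1) (X ^ a i j - X ^ (c - a i j)) := by
      simp only [hT, mul_sum]
      rw [sum_comm, ← sum_neg_distrib]
      refine sum_congr rfl fun i hi => ?_
      rw [sum_comm, ← sum_neg_distrib]
      refine sum_congr rfl fun j hj => ?_
      rw [h3 i j hi hj, mul_neg, neg_neg, mul_sum]
      exact sum_congr rfl fun q _ => by ring
    simp only [T', mul_add, sum_add_distrib]
    rw [h2, h5, ← hQ, map_sub, map_add, h1, map_sum, powerMoment_X_pow]
    simp only [h4, map_sum]
    ring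
  have hT' (q : ℕ) (hq : q < k) : T' q = 0 := by
    induction q using Nat.strong_induction_on with
    | _ q ih =>
      have h := hmoment (2 * q)
      rw [hvanish _ (by omega), Nat.mul_div_cancel_left q two_pos, sum_range_succ,
        sum_eq_zero fun p hp => by
          rw [mem_range] at hp; rw [ih p hp (by omega), mul_zero]] at h
      simpa [two_mul] using h
  have hmain (r : ℕ) : powerMoment (2 * k + 1 + r) P = -(-1) ^ k *
      ∑ t ∈ Finset.range (r / 2 + 1), (-1 : ℚ) ^ t *
          ((k + r - t).choose (k + t) : ℚ) * (c : ℚ) ^ (r - 2 * t) * T (k + t) := by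
    rw [show 2 * k + 1 + r = 2 * k + r + 1 by ring, hmoment,
      show (2 * k + r) / 2 + 1 = k + (r / 2 + 1) by omega, sum_range_add,
      sum_eq_zero fun p hp => by rw [hT' p (mem_range.mp hp), mul_zero], zero_add, neg_mul, mul_sum]
    congr 1
    refine sum_congr rfl fun t _ => ?_
    rw [show 2 * k + r - (k + t) = k + r - t by omega,
      show 2 * k + r - 2 * (k + t) = r - 2 * t by omega]
    simp only [T', if_neg (by omega : k + t ≠ 0), pow_add]
    ring
  have hD := eval_one_iterate_derivative_mul_one_sub_X_pow Q (2 * k + 1) l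
  rw [← hP, eval_one_iterate_derivative_eq_sum_powerMoment (by omega),
    show 2 * k + 1 + l = l + 1 + 2 * k by ring, sum_range_add,
    sum_eq_zero (s := range (2 * k)) fun p hp => by
      rw [hvanish _ (by omega), mul_zero], add_zero, ← sum_range_reflect] at hD
  have hsign : ((-1 : ℚ) ^ k) * (-1) ^ k = 1 := by rw [← mul_pow]; simp
  calc _ = -(-1) ^ k * ((-1) ^ (2 * k + 1) * ((l + 1 + 2 * k).factorial : ℚ) *
        ((derivative^[l] Q).eval 1 / (l.factorial : ℚ))) := by
        rw [show 2 * k + 1 + l = l + 1 + 2 * k by ring, pow_succ, pow_mul]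
        norm_num
        ring
    _ = _ := by
      rw [← hD, mul_sum]
      refine sum_congr rfl fun r hr => ?_
      rw [mem_range] at hr
      rw [show l + 1 - 1 - r = l - r by omega,
        show l + 1 + 2 * k - (l - r) = 2 * k + 1 + r by omega, hmain,
        show 2 * k + 1 + l = l + 1 + 2 * k by ring]
      linear_combination ((-1 : ℚ) ^ (l - r) *
        (∑ S ∈ Finset.powersetCard (l - r) (Finset.Icc 1 (l + 1 + 2 * k - 1)),
          ∏ x ∈ S, (x : ℚ)) * ∑ t ∈ Finset.range (r / 2 + 1), (-1 : ℚ) ^ t *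
          ((k + r - t).choose (k + t) : ℚ) * (c : ℚ) ^ (r - 2 * t) * T (k + t)) * hsign
end

section
/- Let k ≥ 1, s = 2k, c ≥ 1 a natural number, r_1,…,r_k ≥ 1 natural numbers, and a_{ij} natural numbers with 1 ≤ a_{ij} ≤ c for 1 ≤ i ≤ k, 1 ≤ j ≤ r_i. Suppose there exists Q ∈ ℚ[X] with 1 + Σ_{i=1}^{k} (−1)^i Σ_{j=1}^{r_i} ( X^{a_{ij}} + X^{c−a_{ij}} ) + X^c = Q(X)·(1−X)^s in ℚ[X]. Define e_l = Q^{(l)}(1)/l! and ν_j = e_j(1, 2, …, s+l−1). Then for every integer l ≥ 0: (−1)^k (s+l)! e_l = Σ_{r=0}^{l} Σ_{t=0}^{⌊r/2⌋} (−1)^{l−r+t} ν_{l−r} [ C(k+r−t, k+t) + C(k+r−t−1, k+t−1) ] c^{r−2t} Σ_{i=1}^{k} Σ_{j=1}^{r_i} (−1)^i a_{ij}^{k+t} (c−a_{ij})^{k+t}. -/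
open Polynomial Finset

/-- The `m`-th moment `∑ d, p_d * d ^ m` of the coefficient sequence of `p`. -/
noncomputable def moment (m : ℕ) : ℚ[X] →ₗ[ℚ] ℚ :=
  leval (1 : ℚ) ∘ₗ (eulerOp ^ m)

lemma eulerOp_X_pow (d : ℕ) : eulerOp (X ^ d) = (d : ℚ) • X ^ d := by
  cases d with
  | zero => simp [eulerOp]
  | succ d => simp [eulerOp, smul_eq_C_mul]; ring

lemma moment_X_pow (m d : ℕ) : moment m (X ^ d) = (d : ℚ) ^ m := by
  have h : (eulerOp ^ m) (X ^ d) = ((d : ℚ) ^ m) • (X : ℚ[X]) ^ d := by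
    induction m with
    | zero => simp
    | succ m ih =>
      rw [pow_succ, Module.End.mul_apply, eulerOp_X_pow, map_smul, ih, smul_smul, pow_succ, mul_comm]
  simp [moment, h]

lemma pow_dvd_eulerOp {n : ℕ} {p : ℚ[X]} (h : (1 - X) ^ (n + 1) ∣ p) :
    (1 - X) ^ n ∣ eulerOp p := by
  obtain ⟨q, rfl⟩ := h
  refine ⟨X * (-((n : ℚ[X]) + 1) * q + (1 - X) * derivative q), ?_⟩
  simp [eulerOp, derivative_mul, derivative_pow]
  ring

lemma moment_eq_zero {n m : ℕ} (hm : m < n) {p : ℚ[X]} (h : (1 - X) ^ n ∣ p) :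
    moment m p = 0 := by
  induction m generalizing n p with
  | zero =>
    obtain ⟨q, rfl⟩ := h
    simp [moment, Nat.ne_of_gt hm]
  | succ m ih =>
    obtain ⟨n, rfl⟩ : ∃ n', n = n' + 1 := ⟨n - 1, by omega⟩
    have := ih (by omega) (pow_dvd_eulerOp h)
    simpa [moment, pow_succ] using this

lemma cast_descFactorial_eq_prod (d n : ℕ) :
    (d.descFactorial n : ℚ) = ∏ i ∈ range n, ((d : ℚ) - i) := by
  rw [← descPochhammer_eval_eq_descFactorial ℚ, descPochhammer_eval_eq_prod_range]

/-- Signed Stirling numbers of the first kind as elementary symmetric polynomials. -/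
lemma cast_descFactorial_succ_eq_sum (d n : ℕ) :
    (d.descFactorial (n + 1) : ℚ) = ∑ j ∈ range (n + 1), (-1 : ℚ) ^ j *
      (∑ S ∈ powersetCard j (Icc 1 n), ∏ x ∈ S, (x : ℚ)) * (d : ℚ) ^ (n + 1 - j) := by
  have h : ∏ i ∈ Icc 1 n, ((d : ℚ) - i) = ∑ j ∈ range (n + 1), (-1 : ℚ) ^ j *
      (∑ S ∈ powersetCard j (Icc 1 n), ∏ x ∈ S, (x : ℚ)) * (d : ℚ) ^ (n - j) := by
    have h1 : ∀ i ∈ Icc 1 n, (d : ℚ) - i = -(i : ℚ) + d := fun i _ => by ring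
    rw [prod_congr rfl h1, prod_add, sum_powerset, Nat.card_Icc, Nat.add_sub_cancel]
    refine sum_congr rfl fun j _ => ?_
    rw [mul_sum, sum_mul]
    refine sum_congr rfl fun S hS => ?_
    obtain ⟨hS, hc⟩ := mem_powersetCard.mp hS
    rw [prod_neg, prod_const, card_sdiff_of_subset hS, Nat.card_Icc, hc, Nat.add_sub_cancel]
  have h2 : ∏ i ∈ Icc 1 n, ((d : ℚ) - i) = ∏ i ∈ range n, ((d : ℚ) - (i + 1 : ℕ)) := by
    rw [range_eq_Ico, ← Finset.Ico_add_one_right_eq_Icc,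
      prod_Ico_add' (fun i : ℕ => (d : ℚ) - i) 0 n 1]
  rw [cast_descFactorial_eq_prod, prod_range_succ', ← h2, h, sum_mul]
  refine sum_congr rfl fun j hj => ?_
  have : n + 1 - j = n - j + 1 := by have := mem_range.mp hj; omega
  rw [this, pow_succ]
  push_cast
  ring

lemma eval_one_iterate_derivative_succ (n : ℕ) (p : ℚ[X]) :
    (derivative^[n + 1] p).eval 1 = ∑ j ∈ range (n + 1), (-1 : ℚ) ^ j *
      (∑ S ∈ powersetCard j (Icc 1 n), ∏ x ∈ S, (x : ℚ)) * moment (n + 1 - j) p := by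
  induction p using Polynomial.induction_on' with
  | add p q hp hq =>
    rw [iterate_map_add, eval_add, hp, hq, ← sum_add_distrib]
    exact sum_congr rfl fun j _ => by rw [map_add]; ring
  | monomial d a =>
    rw [← C_mul_X_pow_eq_monomial, iterate_derivative_C_mul, iterate_derivative_X_pow_eq_natCast_mul]
    simp only [← smul_eq_C_mul, map_smul, moment_X_pow, eval_smul, eval_mul, eval_natCast,
      eval_pow, eval_X, one_pow, mul_one, smul_eq_mul]
    rw [cast_descFactorial_succ_eq_sum, mul_sum]
    exact sum_congr rfl fun j _ => by ring

lemma eval_one_iterate_derivative_mul_pow (n l : ℕ) (q : ℚ[X]) :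
    (derivative^[n + l] (q * (X - 1) ^ n)).eval 1 =
      ((n + l).factorial : ℚ) * ((derivative^[l] q).eval 1 / (l.factorial : ℚ)) := by
  have h1 : taylor 1 (q * (X - 1) ^ n) = taylor 1 q * X ^ n := by
    simp [taylor_mul, taylor_pow]
  have h2 := congrArg (fun p => coeff p (n + l)) h1
  simp only [add_comm n l, coeff_mul_X_pow, taylor_coeff] at h2
  have key : ∀ (m : ℕ) (p : ℚ[X]), (derivative^[m] p).eval 1 =
      (m.factorial : ℚ) * (hasseDeriv m p).eval 1 := fun m p => by
    rw [← factorial_smul_hasseDeriv]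
    simp
  rw [key, key, add_comm n l, h2]
  have : (l.factorial : ℚ) ≠ 0 := by exact_mod_cast l.factorial_ne_zero
  field_simp

section PowerSums

variable {R : Type*} [CommRing R]

lemma sum_choose_mul_pow_add_two (c q : R) (m : ℕ) :
    ∑ t ∈ range (m + 3), ((m + 2 - t).choose t : R) * c ^ (m + 2 - 2 * t) * q ^ t =
      c * ∑ t ∈ range (m + 2), ((m + 1 - t).choose t : R) * c ^ (m + 1 - 2 * t) * q ^ t +
      q * ∑ t ∈ range (m + 1), ((m - t).choose t : R) * c ^ (m - 2 * t) * q ^ t := by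
  rw [sum_range_succ', sum_range_succ, sum_range_succ' _ (m + 1)]
  have h0 : (m + 2 - (m + 1 + 1)).choose (m + 1 + 1) = 0 := Nat.choose_eq_zero_of_lt (by omega)
  have : ∀ t ∈ range (m + 1),
      ((m + 2 - (t + 1)).choose (t + 1) : R) * c ^ (m + 2 - 2 * (t + 1)) * q ^ (t + 1) =
      c * (((m + 1 - (t + 1)).choose (t + 1) : R) * c ^ (m + 1 - 2 * (t + 1)) * q ^ (t + 1)) +
      q * (((m - t).choose t : R) * c ^ (m - 2 * t) * q ^ t) := by
    intro t ht
    have ht := mem_range.mp ht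
    rw [show m + 2 - (t + 1) = m - t + 1 by omega, show m + 1 - (t + 1) = m - t by omega,
      Nat.choose_succ_succ, show m + 2 - 2 * (t + 1) = m - 2 * t by omega]
    by_cases h : 2 * t + 1 ≤ m
    · rw [show m - 2 * t = m + 1 - 2 * (t + 1) + 1 by omega]
      push_cast
      ring
    · rw [Nat.choose_eq_zero_of_lt (show m - t < t.succ by omega)]
      push_cast
      ring
  rw [sum_congr rfl this, sum_add_distrib, ← mul_sum, ← mul_sum, h0]
  simp only [Nat.choose_zero_right, Nat.cast_zero, Nat.cast_one, Nat.sub_zero, mul_zero]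
  ring

lemma pow_add_pow_eq_sub (x y : R) (m : ℕ) :
    x ^ (m + 2) + y ^ (m + 2) =
      ∑ t ∈ range (m + 3), ((m + 2 - t).choose t : R) * (x + y) ^ (m + 2 - 2 * t) * (-(x * y)) ^ t -
      x * y * ∑ t ∈ range (m + 1), ((m - t).choose t : R) * (x + y) ^ (m - 2 * t) *
        (-(x * y)) ^ t := by
  induction m using Nat.twoStepInduction with
  | zero => simp [sum_range_succ]; ring
  | one => simp [sum_range_succ]; ring
  | more m ih1 ih2 =>
    rw [sum_choose_mul_pow_add_two _ _ (m + 2)]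
    have h : ∀ n, x ^ (n + 2 + 2) + y ^ (n + 2 + 2) = (x + y) * (x ^ (n + 1 + 2) + y ^ (n + 1 + 2))
      - x * y * (x ^ (n + 2) + y ^ (n + 2)) := fun n => by ring
    rw [h, ih1, ih2, sum_choose_mul_pow_add_two _ _ m]
    ring

/-- The Girard-Waring formula for two variables. -/
lemma pow_add_pow_eq_sum (x y : R) {m : ℕ} (hm : 1 ≤ m) :
    x ^ m + y ^ m = (x + y) ^ m + ∑ t ∈ range (m / 2), (-1 : R) ^ (t + 1) *
      (((m - (t + 1)).choose (t + 1) : R) + ((m - (t + 1) - 1).choose t : R)) *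
      (x + y) ^ (m - 2 * (t + 1)) * (x * y) ^ (t + 1) := by
  obtain rfl | ⟨m, rfl⟩ : m = 1 ∨ ∃ n, m = n + 2 := by
    rcases m with _ | _ | m
    · omega
    · exact .inl rfl
    · exact .inr ⟨m, rfl⟩
  · simp
  · have hsub : range ((m + 2) / 2) ⊆ range (m + 1) := range_subset_range.mpr (by omega)
    rw [pow_add_pow_eq_sub, sum_range_succ', sum_range_succ, sum_subset hsub, add_right_comm,
      add_sub_right_comm, add_sub_right_comm, mul_sum, ← sum_sub_distrib]
    · have h0 : (m + 2 - (m + 1 + 1)).choose (m + 1 + 1) = 0 :=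
        Nat.choose_eq_zero_of_lt (by omega)
      rw [h0]
      simp only [Nat.sub_zero, Nat.choose_zero_right, Nat.cast_one, one_mul, mul_zero, pow_zero,
        mul_one, Nat.cast_zero, zero_mul, add_zero]
      rw [add_comm]
      congr 1
      refine sum_congr rfl fun t ht => ?_
      have ht := mem_range.mp ht
      rw [show m + 2 - (t + 1) - 1 = m - t by omega, show m + 2 - 2 * (t + 1) = m - 2 * t by omega,
        neg_pow (x * y) (t + 1), neg_pow (x * y) t]
      ring
    · intro t ht ht'
      have ht := mem_range.mp ht
      have ht' : ¬ t < (m + 2) / 2 := fun h => ht' (mem_range.mpr h)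
      rw [Nat.choose_eq_zero_of_lt (show m + 2 - (t + 1) < t + 1 by omega),
        Nat.choose_eq_zero_of_lt (show m + 2 - (t + 1) - 1 < t by omega)]
      simp

end PowerSums

/-- Hilbert coefficients of a Gorenstein algebra of even grade `s = 2k` in terms of
the shifts `a_{ij}`, `c - a_{ij}`, `c` of its self-dual resolution. -/
theorem stmt_7 (k : ℕ) (hk : 1 ≤ k) (c : ℕ) (hc : 1 ≤ c) (r_ : ℕ → ℕ)
    (hr : ∀ i ∈ Finset.Icc 1 k, 1 ≤ r_ i) (a : ℕ → ℕ → ℕ)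
    (ha : ∀ i ∈ Finset.Icc 1 k, ∀ j ∈ Finset.Icc 1 (r_ i), 1 ≤ a i j ∧ a i j ≤ c)
    (Q : ℚ[X])
    (hQ : (1 : ℚ[X]) + ∑ i ∈ Finset.Icc 1 k, (-1 : ℚ[X]) ^ i *
        ∑ j ∈ Finset.Icc 1 (r_ i), ((X : ℚ[X]) ^ (a i j) + X ^ (c - a i j))
        + X ^ c = Q * (1 - X) ^ (2 * k)) (l : ℕ) :
    (-1 : ℚ) ^ k * ((2 * k + l).factorial : ℚ) *
        ((Polynomial.derivative^[l] Q).eval 1 / (l.factorial : ℚ)) =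
      ∑ r ∈ Finset.range (l + 1), ∑ t ∈ Finset.range (r / 2 + 1),
        (-1 : ℚ) ^ (l - r + t) *
        (∑ S ∈ Finset.powersetCard (l - r) (Finset.Icc 1 (2 * k + l - 1)),
          ∏ x ∈ S, (x : ℚ)) *
        (((k + r - t).choose (k + t) : ℚ) + ((k + r - t - 1).choose (k + t - 1) : ℚ)) *
        (c : ℚ) ^ (r - 2 * t) *
        ∑ i ∈ Finset.Icc 1 k, ∑ j ∈ Finset.Icc 1 (r_ i),
          (-1 : ℚ) ^ i * (a i j : ℚ) ^ (k + t) * ((c : ℚ) - (a i j : ℚ)) ^ (k + t) := by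
  set P : ℚ[X] := Q * (1 - X) ^ (2 * k) with hP
  set W : ℕ → ℚ := fun t => ∑ i ∈ Icc 1 k, ∑ j ∈ Icc 1 (r_ i),
    (-1 : ℚ) ^ i * (a i j : ℚ) ^ t * ((c : ℚ) - (a i j : ℚ)) ^ t with hW
  have hdvd : (1 - X) ^ (2 * k) ∣ P := Dvd.intro_left _ rfl
  have hmom : ∀ m, moment m P = (0 : ℚ) ^ m + ∑ i ∈ Icc 1 k, ∑ j ∈ Icc 1 (r_ i),
      (-1 : ℚ) ^ i * ((a i j : ℚ) ^ m + ((c : ℚ) - a i j) ^ m) + (c : ℚ) ^ m := by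
    intro m
    have hone : moment m 1 = (0 : ℚ) ^ m := by simpa using moment_X_pow m 0
    rw [← hQ, map_add, map_add, moment_X_pow, hone, map_sum]
    congr 2
    refine sum_congr rfl fun i hi => ?_
    have hsign : ∀ p : ℚ[X], (-1 : ℚ[X]) ^ i * p = ((-1 : ℚ) ^ i) • p := fun p => by
      simp [smul_eq_C_mul]
    rw [hsign, map_smul, map_sum, smul_eq_mul, mul_sum]
    refine sum_congr rfl fun j hj => ?_
    rw [map_add, moment_X_pow, moment_X_pow, Nat.cast_sub (ha i hi j hj).2]
  have hW0 : 1 + W 0 = 0 := by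
    have h := hmom 0
    rw [moment_eq_zero (by omega) hdvd] at h
    simp only [pow_zero, ← sum_mul] at h
    simp only [hW, pow_zero, mul_one]
    linarith
  have hgirard : ∀ m, 1 ≤ m → moment m P = ∑ t ∈ range (m / 2), (-1 : ℚ) ^ (t + 1) *
      (((m - (t + 1)).choose (t + 1) : ℚ) + ((m - (t + 1) - 1).choose t : ℚ)) *
      (c : ℚ) ^ (m - 2 * (t + 1)) * W (t + 1) := by
    intro m hm
    have hterm : ∀ i j, (-1 : ℚ) ^ i * ((a i j : ℚ) ^ m + ((c : ℚ) - a i j) ^ m) =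
        (c : ℚ) ^ m * ((-1 : ℚ) ^ i * (a i j : ℚ) ^ 0 * ((c : ℚ) - a i j) ^ 0) +
        ∑ t ∈ range (m / 2), (-1 : ℚ) ^ (t + 1) *
          (((m - (t + 1)).choose (t + 1) : ℚ) + ((m - (t + 1) - 1).choose t : ℚ)) *
          (c : ℚ) ^ (m - 2 * (t + 1)) *
          ((-1 : ℚ) ^ i * (a i j : ℚ) ^ (t + 1) * ((c : ℚ) - a i j) ^ (t + 1)) := by
      intro i j
      rw [pow_add_pow_eq_sum _ _ hm, mul_add, mul_sum, add_sub_cancel]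
      congr 1
      · ring
      · exact sum_congr rfl fun t _ => by rw [mul_pow]; ring
    rw [hmom]
    simp only [hterm, sum_add_distrib, ← mul_sum]
    have hswap : ∀ f : ℕ → ℕ → ℕ → ℚ,
        ∑ i ∈ Icc 1 k, ∑ j ∈ Icc 1 (r_ i), ∑ t ∈ range (m / 2), f i j t =
        ∑ t ∈ range (m / 2), ∑ i ∈ Icc 1 k, ∑ j ∈ Icc 1 (r_ i), f i j t := fun f => by
      rw [sum_comm]
      exact sum_congr rfl fun i _ => sum_comm
    rw [hswap]
    simp only [← mul_sum]
    rw [zero_pow (by omega)]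
    linear_combination (c : ℚ) ^ m * hW0
  have hWzero : ∀ t, t + 1 < k → W (t + 1) = 0 := by
    intro t
    induction t using Nat.strong_induction_on with
    | _ t ih =>
      intro ht
      have h := hgirard (2 * (t + 1)) (by omega)
      rw [moment_eq_zero (by omega) hdvd, Nat.mul_div_cancel_left _ two_pos, sum_range_succ,
        sum_eq_zero fun u hu => by
          rw [ih u (mem_range.mp hu) (by have := mem_range.mp hu; omega), mul_zero]] at h
      rw [show 2 * (t + 1) - (t + 1) = t + 1 by omega] at h
      simpa [show (1 : ℚ) + 1 ≠ 0 by norm_num] using h.symm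
  have hmain : ∀ r, (-1 : ℚ) ^ k * moment (2 * k + r) P = ∑ t ∈ range (r / 2 + 1), (-1 : ℚ) ^ t *
      (((k + r - t).choose (k + t) : ℚ) + ((k + r - t - 1).choose (k + t - 1) : ℚ)) *
      (c : ℚ) ^ (r - 2 * t) * W (k + t) := by
    intro r
    rw [hgirard _ (by omega), show (2 * k + r) / 2 = (k - 1) + (r / 2 + 1) by omega,
      sum_range_add, sum_eq_zero fun u hu => by
        rw [hWzero u (by have := mem_range.mp hu; omega), mul_zero], zero_add, mul_sum]
    refine sum_congr rfl fun t ht => ?_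
    have ht := mem_range.mp ht
    rw [show k - 1 + t + 1 = k + t by omega, show 2 * k + r - (k + t) = k + r - t by omega,
      show 2 * k + r - 2 * (k + t) = r - 2 * t by omega, show k - 1 + t = k + t - 1 by omega,
      pow_add]
    have hs : (-1 : ℚ) ^ k * (-1) ^ k = 1 := by rw [← mul_pow]; simp
    linear_combination ((-1 : ℚ) ^ t *
      (((k + r - t).choose (k + t) : ℚ) + ((k + r - t - 1).choose (k + t - 1) : ℚ)) *
      (c : ℚ) ^ (r - 2 * t) * W (k + t)) * hs
  have hPX : P = Q * (X - 1) ^ (2 * k) := by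
    rw [hP, ← neg_sub X (1 : ℚ[X]), Even.neg_pow (even_two_mul k)]
  have hsucc : 2 * k + l = 2 * k + l - 1 + 1 := by omega
  rw [mul_assoc, ← eval_one_iterate_derivative_mul_pow, ← hPX, hsucc,
    eval_one_iterate_derivative_succ, ← hsucc,
    ← sum_subset (range_subset_range.mpr (show l + 1 ≤ 2 * k + l by omega)), ← sum_range_reflect,
    mul_sum]
  · refine sum_congr rfl fun r hr => ?_
    have hr := mem_range.mp hr
    rw [show l + 1 - 1 - r = l - r by omega, show 2 * k + l - (l - r) = 2 * k + r by omega,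
      mul_left_comm, hmain, mul_sum]
    exact sum_congr rfl fun t _ => by rw [pow_add]; ring
  · intro j _ hj
    rw [moment_eq_zero (by have := mt mem_range.mpr hj; omega) hdvd, mul_zero]
end

section
/- For all real numbers a and c and every integer n ≥ 1: (c−a)^n − a^n = Σ_{t=0}^{⌊n/2⌋} (−1)^t · C(n−t−1, t) · a^t (c−a)^t (c−2a) · c^{n−2t−1}. -/
open Finset

theorem choose_mul_pow_recurrence {R : Type*} [CommRing R] (p c : R) (m t : ℕ) :
    ((m + 2 - (t + 1)).choose (t + 1) : R) * p ^ (t + 1) * c ^ (m + 2 - 2 * (t + 1)) =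
      c * (((m + 1 - (t + 1)).choose (t + 1) : R) * p ^ (t + 1) * c ^ (m + 1 - 2 * (t + 1))) +
        p * (((m - t).choose t : R) * p ^ t * c ^ (m - 2 * t)) := by
  have e1 : m + 1 - (t + 1) = m - t := by omega
  have e2 : m + 2 - 2 * (t + 1) = m - 2 * t := by omega
  rw [e1, e2]
  rcases le_or_gt t m with h | h
  · have e3 : m + 2 - (t + 1) = (m - t) + 1 := by omega
    rw [e3, Nat.choose_succ_succ]
    push_cast
    rcases le_or_gt (2 * t + 1) m with h' | h'
    · have e4 : m - 2 * t = (m + 1 - 2 * (t + 1)) + 1 := by omega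
      rw [e4]
      ring
    · rw [Nat.choose_eq_zero_of_lt (show m - t < t + 1 by omega)]
      push_cast
      ring
  · rw [Nat.choose_eq_zero_of_lt (show m + 2 - (t + 1) < t + 1 by omega),
      Nat.choose_eq_zero_of_lt (show m - t < t + 1 by omega),
      Nat.choose_eq_zero_of_lt (show m - t < t by omega)]
    simp

theorem pow_succ_sub_pow_succ_eq_sum_choose {R : Type*} [CommRing R] (a c : R) :
    ∀ m N : ℕ, m / 2 < N → (c - a) ^ (m + 1) - a ^ (m + 1) =
      (c - 2 * a) * ∑ t ∈ range N,
        ((m - t).choose t : R) * (-(a * (c - a))) ^ t * c ^ (m - 2 * t)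
  | 0, N + 1, _ => by
    rw [sum_range_succ', sum_eq_zero (fun t _ => by simp)]
    simp
    ring
  | 1, N + 1, _ => by
    rw [sum_range_succ', sum_eq_zero (fun t _ => by
      rw [Nat.choose_eq_zero_of_lt (by omega)]; simp)]
    simp
    ring
  | m + 2, N + 1, h => by
    have h1 := pow_succ_sub_pow_succ_eq_sum_choose a c (m + 1) (N + 1) (by omega)
    have h0 := pow_succ_sub_pow_succ_eq_sum_choose a c m N (by omega)
    rw [sum_range_succ'] at h1 ⊢
    simp only [choose_mul_pow_recurrence, sum_add_distrib, ← mul_sum]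
    simp only [Nat.choose_zero_right, pow_zero, mul_zero, Nat.sub_zero] at h1 ⊢
    linear_combination c * h1 - a * (c - a) * h0

/-- `(c-a)^n - a^n = Σ_{t=0}^{⌊n/2⌋} (-1)^t C(n-t-1,t) a^t (c-a)^t (c-2a) c^{n-2t-1}`. -/
theorem stmt_8 (a c : ℝ) (n : ℕ) (hn : 1 ≤ n) :
    (c - a) ^ n - a ^ n =
      ∑ t ∈ Finset.range (n / 2 + 1), (-1 : ℝ) ^ t * ((n - t - 1).choose t : ℝ) *
        a ^ t * (c - a) ^ t * (c - 2 * a) * c ^ (n - 2 * t - 1) := by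
  obtain ⟨m, rfl⟩ := Nat.exists_eq_add_of_le' hn
  rw [pow_succ_sub_pow_succ_eq_sum_choose a c m ((m + 1) / 2 + 1) (by omega), mul_sum]
  refine sum_congr rfl fun t _ => ?_
  rw [show m + 1 - t - 1 = m - t by omega, show m + 1 - 2 * t - 1 = m - 2 * t by omega,
    neg_pow, mul_pow]
  ring
end

section
/- For all real numbers a and c and every integer n ≥ 1: (c−a)^n + a^n = Σ_{t=0}^{⌊n/2⌋} (−1)^t · C(n−t, t) · a^t (c−a)^t · c^{n−2t} + Σ_{t=1}^{⌊n/2⌋} (−1)^t · C(n−t−1, t−1) · a^t (c−a)^t · c^{n−2t}. -/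
open Finset

/-- The sum `Σ_t C(n-t,t) q^t p^{n-2t}`, the general Lucas polynomial sequence in `p`, `q`. -/
def lucasSum {R : Type*} [CommSemiring R] (p q : R) (n : ℕ) : R :=
  ∑ x ∈ antidiagonal n, (x.2.choose x.1 : R) * q ^ x.1 * p ^ (x.2 - x.1)

theorem choose_succ_mul_pow_sub {R : Type*} [CommSemiring R] (p : R) (i j : ℕ) :
    (i.choose (j + 1) : R) * p ^ (i - j) = p * ((i.choose (j + 1) : R) * p ^ (i - (j + 1))) := by
  rcases lt_or_ge i (j + 1) with h | h
  · simp [Nat.choose_eq_zero_of_lt h]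
  · obtain ⟨k, rfl⟩ := Nat.exists_eq_add_of_le h
    rw [show j + 1 + k - j = k + 1 by omega, show j + 1 + k - (j + 1) = k by omega]
    ring

theorem lucasSum_add_two {R : Type*} [CommSemiring R] (p q : R) (n : ℕ) :
    lucasSum p q (n + 2) = p * lucasSum p q (n + 1) + q * lucasSum p q n := by
  have h (i j : ℕ) : ((i + 1).choose (j + 1) : R) * q ^ (j + 1) * p ^ (i + 1 - (j + 1)) =
      p * ((i.choose (j + 1) : R) * q ^ (j + 1) * p ^ (i - (j + 1))) +
        q * ((i.choose j : R) * q ^ j * p ^ (i - j)) := by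
    have e := choose_succ_mul_pow_sub p i j
    rw [Nat.choose_succ_succ', Nat.add_sub_add_right, Nat.cast_add]
    calc _ = q ^ (j + 1) * ((i.choose (j + 1) : R) * p ^ (i - j)) +
          q * ((i.choose j : R) * q ^ j * p ^ (i - j)) := by ring
      _ = _ := by rw [e]; ring
  simp only [lucasSum]
  rw [Finset.Nat.antidiagonal_succ_succ', Finset.Nat.antidiagonal_succ (n := n)]
  simp only [sum_cons, sum_map, Function.Embedding.prodMap, Function.Embedding.coeFn_mk,
    Prod.map, Function.Embedding.refl_apply, Nat.succ_eq_add_one, h, sum_add_distrib, mul_sum,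
    mul_add]
  simp
  ring

theorem lucasSum_eq_sum_range {R : Type*} [CommSemiring R] (p q : R) (n : ℕ) :
    lucasSum p q n =
      ∑ t ∈ range (n / 2 + 1), ((n - t).choose t : R) * q ^ t * p ^ (n - 2 * t) := by
  rw [lucasSum, Finset.Nat.sum_antidiagonal_eq_sum_range_succ
    (fun i j ↦ (j.choose i : R) * q ^ i * p ^ (j - i))]
  symm
  have hs : range (n / 2 + 1) ⊆ range n.succ := range_subset_range.2 (by omega)
  rw [← sum_subset hs]
  · refine sum_congr rfl fun t _ ↦ ?_
    rw [show n - 2 * t = n - t - t by omega]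
  · intro t _ ht
    rw [mem_range] at ht
    simp [Nat.choose_eq_zero_of_lt (show n - t < t by omega)]

theorem pow_add_pow_eq_lucasSum {R : Type*} [CommRing R] (a b : R) (n : ℕ) :
    b ^ (n + 2) + a ^ (n + 2) =
      lucasSum (a + b) (-(a * b)) (n + 2) + -(a * b) * lucasSum (a + b) (-(a * b)) n := by
  have h0 : lucasSum (a + b) (-(a * b)) 0 = 1 := by simp [lucasSum]
  have h1 : lucasSum (a + b) (-(a * b)) 1 = a + b := by
    simp [lucasSum, Finset.Nat.antidiagonal_succ]
  induction n using Nat.twoStepInduction with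
  | zero => rw [lucasSum_add_two, h0, h1]; ring
  | one => rw [lucasSum_add_two, lucasSum_add_two, h0, h1]; ring
  | more n ih₀ ih₁ =>
    have e := lucasSum_add_two (a + b) (-(a * b)) (n + 2)
    have e' := lucasSum_add_two (a + b) (-(a * b)) n
    linear_combination (a + b) * ih₁ - a * b * ih₀ - e + a * b * e'

/-- `(c-a)^n + a^n = Σ_{t=0}^{⌊n/2⌋} (-1)^t C(n-t,t) a^t (c-a)^t c^{n-2t}
  + Σ_{t=1}^{⌊n/2⌋} (-1)^t C(n-t-1,t-1) a^t (c-a)^t c^{n-2t}`. -/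
theorem stmt_9 (a c : ℝ) (n : ℕ) (hn : 1 ≤ n) :
    (c - a) ^ n + a ^ n =
      (∑ t ∈ Finset.range (n / 2 + 1), (-1 : ℝ) ^ t * ((n - t).choose t : ℝ) *
        a ^ t * (c - a) ^ t * c ^ (n - 2 * t)) +
      ∑ t ∈ Finset.Icc 1 (n / 2), (-1 : ℝ) ^ t * ((n - t - 1).choose (t - 1) : ℝ) *
        a ^ t * (c - a) ^ t * c ^ (n - 2 * t) := by
  have h_term (t : ℕ) (k x : ℝ) : (-1 : ℝ) ^ t * k * a ^ t * (c - a) ^ t * x =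
      k * (-(a * (c - a))) ^ t * x := by
    rw [neg_pow (a * (c - a)), mul_pow]
    ring
  simp only [h_term]
  obtain rfl | ⟨m, rfl⟩ : n = 1 ∨ ∃ m, n = m + 2 := by
    rcases n with _ | _ | m
    · omega
    · simp
    · exact Or.inr ⟨m, rfl⟩
  · simp
  · have h := pow_add_pow_eq_lucasSum a (c - a) m
    rw [add_sub_cancel] at h
    rw [h, lucasSum_eq_sum_range, lucasSum_eq_sum_range c _ m, mul_sum]
    congr 1
    rw [range_eq_Ico, ← Ico_add_one_right_eq_Icc, show (m + 2) / 2 + 1 = m / 2 + 1 + 1 by omega,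
      ← sum_Ico_add' _ 0 (m / 2 + 1) 1]
    refine sum_congr rfl fun t _ ↦ ?_
    rw [show m + 2 - (t + 1) - 1 = m - t by omega, show m + 2 - 2 * (t + 1) = m - 2 * t by omega,
      Nat.add_sub_cancel]
    ring
end

section
/- Let R be a commutative ring, k ≥ 1, t ≥ 0, and α_1,…,α_k ∈ R. Let V_t(α_1,…,α_k) be the determinant of the k×k matrix whose j-th column is (1, α_j, α_j^2, …, α_j^{k−2}, α_j^{k−1+t}) (i.e., the Vandermonde matrix with the last row's exponent k−1 replaced by k−1+t). Then V_t(α_1,…,α_k) = ( Π_{1 ≤ j < i ≤ k} (α_i − α_j) ) · h_t(α_1,…,α_k). -/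
open Finset

/-- Sum over `antidiagonalTuple (n + 1) t`, splitting off the first entry. -/
theorem sum_antidiagonalTuple_succ {M : Type*} [AddCommMonoid M] (n t : ℕ)
    (f : (Fin (n + 1) → ℕ) → M) :
    ∑ β ∈ Finset.Nat.antidiagonalTuple (n + 1) t, f β =
      ∑ p ∈ antidiagonal t, ∑ β ∈ Finset.Nat.antidiagonalTuple n p.2, f (Fin.cons p.1 β) := by
  rw [Finset.sum_sigma']
  refine Finset.sum_bij' (fun β _ => ⟨(β 0, ∑ i, Fin.tail β i), Fin.tail β⟩)
    (fun x _ => Fin.cons x.1.1 x.2) ?_ ?_ ?_ ?_ ?_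
  · intro β hβ
    simp only [Finset.Nat.mem_antidiagonalTuple, Fin.sum_univ_succ] at hβ
    simp [Finset.Nat.mem_antidiagonalTuple, Fin.tail, hβ]
  · rintro ⟨⟨a, b⟩, β⟩ h
    simp only [mem_sigma, HasAntidiagonal.mem_antidiagonal, Finset.Nat.mem_antidiagonalTuple] at h
    simp [Finset.Nat.mem_antidiagonalTuple, Fin.sum_univ_succ, h]
  · intro β _
    simp
  · rintro ⟨⟨a, b⟩, β⟩ h
    simp only [mem_sigma, HasAntidiagonal.mem_antidiagonal, Finset.Nat.mem_antidiagonalTuple] at h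
    simp [h]
  · intro β _
    simp

/-- Splitting off the first variable of a complete homogeneous symmetric polynomial. -/
theorem sum_antidiagonalTuple_prod_pow_succ {R : Type*} [CommRing R] (n t : ℕ)
    (α : Fin (n + 1) → R) :
    ∑ β ∈ Finset.Nat.antidiagonalTuple (n + 1) (t + 1), ∏ i, α i ^ β i =
      (∑ β ∈ Finset.Nat.antidiagonalTuple n (t + 1), ∏ i, Fin.tail α i ^ β i) +
        α 0 * ∑ β ∈ Finset.Nat.antidiagonalTuple (n + 1) t, ∏ i, α i ^ β i := by
  simp only [sum_antidiagonalTuple_succ, Finset.Nat.sum_antidiagonal_succ, Fin.prod_univ_succ,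
    Fin.cons_zero, Fin.cons_succ, Fin.tail, pow_zero, one_mul, Finset.mul_sum, pow_succ']
  simp only [mul_assoc]

open Polynomial in
/-- Modulo `∏ i, (X - α i)`, the monomial `X ^ (n + t)` is congruent to a polynomial of degree at
most `n` whose coefficient of `X ^ n` is the complete homogeneous symmetric polynomial `h_t`. -/
theorem exists_dvd_X_pow_sub {R : Type*} [CommRing R] (n t : ℕ) (α : Fin (n + 1) → R) :
    ∃ Q : R[X], Q.natDegree ≤ n ∧
      Q.coeff n = ∑ β ∈ Finset.Nat.antidiagonalTuple (n + 1) t, ∏ i, α i ^ β i ∧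
      (∏ i, (X - C (α i))) ∣ X ^ (n + t) - Q := by
  induction n generalizing t with
  | zero =>
    refine ⟨C (α 0 ^ t), natDegree_C _ |>.le, by rw [coeff_C_zero]; simp, ?_⟩
    simpa using sub_dvd_pow_sub_pow (X : R[X]) (C (α 0)) t
  | succ n ihn =>
    induction t with
    | zero =>
      refine ⟨X ^ (n + 1), natDegree_X_pow_le _, ?_, by simp⟩
      simp [Finset.Nat.antidiagonalTuple_zero_right]
    | succ t iht =>
      obtain ⟨Q, hQ, hc, A, hA⟩ := iht
      obtain ⟨S, hS, hd, B, hB⟩ := ihn (t + 1) (Fin.tail α)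
      refine ⟨C (α 0) * Q + (X - C (α 0)) * S, ?_, ?_, C (α 0) * A + B, ?_⟩
      · refine natDegree_add_le_of_degree_le ?_ ?_
        · exact (natDegree_C_mul_le _ _).trans hQ
        · refine natDegree_mul_le.trans ?_
          have := natDegree_X_sub_C_le (α 0)
          omega
      · rw [sum_antidiagonalTuple_prod_pow_succ, ← hc, ← hd, coeff_add, coeff_C_mul, sub_mul,
          coeff_sub, coeff_X_mul, coeff_C_mul, coeff_eq_zero_of_natDegree_lt (Nat.lt_succ_of_le hS)]
        ring
      · rw [Fin.prod_univ_succ] at hA ⊢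
        simp only [Fin.tail] at hB
        linear_combination C (α 0) * hA + (X - C (α 0)) * hB

/-- The generalized Vandermonde determinant `V_t`, obtained from the Vandermonde matrix by
replacing the last row's exponent `k-1` by `k-1+t`, factors as the Vandermonde product
times the complete homogeneous symmetric polynomial `h_t`. -/
theorem stmt_10 (R : Type*) [CommRing R] (k t : ℕ) (hk : 1 ≤ k) (α : Fin k → R) :
    (Matrix.of fun i j : Fin k =>
        if (i : ℕ) = k - 1 then α j ^ (k - 1 + t) else α j ^ (i : ℕ)).det =
      (∏ i : Fin k, ∏ j ∈ Finset.univ.filter (fun j : Fin k => j < i), (α i - α j)) *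
        ∑ β ∈ Finset.Nat.antidiagonalTuple k t, ∏ i : Fin k, α i ^ β i := by
  obtain ⟨n, rfl⟩ : ∃ n, k = n + 1 := ⟨k - 1, by omega⟩
  obtain ⟨Q, hQ, hc, hdvd⟩ := exists_dvd_X_pow_sub n t α
  have heval (j : Fin (n + 1)) : α j ^ (n + t) = ∑ i : Fin (n + 1), Q.coeff i * α j ^ (i : ℕ) := by
    have h := (Finset.dvd_prod_of_mem (fun i => Polynomial.X - Polynomial.C (α i))
      (Finset.mem_univ j)).trans hdvd
    rw [Polynomial.dvd_iff_isRoot, Polynomial.IsRoot.def, Polynomial.eval_sub, sub_eq_zero,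
      Polynomial.eval_pow, Polynomial.eval_X,
      Polynomial.eval_eq_sum_range' (Nat.lt_succ_of_le hQ)] at h
    rw [h, Finset.sum_range]
  have hM : (Matrix.of fun i j : Fin (n + 1) =>
        if (i : ℕ) = n + 1 - 1 then α j ^ (n + 1 - 1 + t) else α j ^ (i : ℕ)) =
      (Matrix.vandermonde α).transpose.updateRow (Fin.last n)
        (∑ i : Fin (n + 1), Q.coeff i • (Matrix.vandermonde α).transpose i) := by
    ext i j
    by_cases hi : i = Fin.last n
    · subst hi
      simp [heval, Matrix.vandermonde_apply]
    · have : (i : ℕ) ≠ n := fun h => hi (Fin.ext h)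
      simp [hi, this, Matrix.vandermonde_apply]
  rw [hM, Matrix.det_updateRow_sum, Matrix.det_transpose, Matrix.det_vandermonde, Fin.val_last, hc,
    smul_eq_mul, mul_comm]
  congr 1
  exact Finset.prod_comm' (by simp)
end

section
/- Let k ≥ 1, t ≥ 0, and let α_1,…,α_k be real numbers with 0 ≤ α_1 ≤ α_2 ≤ … ≤ α_k. Let V_t(α_1,…,α_k) be the determinant of the k×k matrix whose j-th column is (1, α_j, α_j^2, …, α_j^{k−2}, α_j^{k−1+t}). Then V_t(α_1,…,α_k) ≥ 0. -/
open Finset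

open Polynomial in
/-- Synthetic division by `X - a` with `0 ≤ a` preserves nonnegativity of coefficients. -/
theorem coeff_divByMonic_X_sub_C_nonneg {f : ℝ[X]} (hf : ∀ i, 0 ≤ f.coeff i) {a : ℝ}
    (ha : 0 ≤ a) (i : ℕ) : 0 ≤ (f /ₘ (X - C a)).coeff i := by
  rw [coeff_divByMonic_X_sub_C]
  exact Finset.sum_nonneg fun j _ => mul_nonneg (pow_nonneg ha _) (hf j)

open Polynomial in
/-- The polynomial of degree at most `n` interpolating a polynomial with nonnegative coefficients
at `n + 1` nonnegative nodes can be chosen with nonnegative coefficient of `X ^ n`. -/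
theorem exists_interpolant_coeff_nonneg (n : ℕ) (f : ℝ[X]) (hf : ∀ i, 0 ≤ f.coeff i)
    (α : Fin (n + 1) → ℝ) (hα : ∀ i, 0 ≤ α i) :
    ∃ g : ℝ[X], g.natDegree ≤ n ∧ 0 ≤ g.coeff n ∧ ∀ j, g.eval (α j) = f.eval (α j) := by
  induction n generalizing f with
  | zero =>
    refine ⟨C (f.eval (α 0)), by simp, ?_, fun j => ?_⟩
    · rw [coeff_C_zero, eval_eq_sum]
      exact Finset.sum_nonneg fun i _ => mul_nonneg (hf i) (pow_nonneg (hα 0) _)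
    · rw [eval_C, Fin.fin_one_eq_zero j]
  | succ n ih =>
    obtain ⟨g, hdeg, hcoeff, heval⟩ := ih (f /ₘ (X - C (α 0)))
      (coeff_divByMonic_X_sub_C_nonneg hf (hα 0)) (fun j => α j.succ) fun j => hα _
    have hdiv := modByMonic_add_div f (X - C (α 0))
    rw [modByMonic_X_sub_C_eq_C_eval] at hdiv
    refine ⟨C (f.eval (α 0)) + (X - C (α 0)) * g, ?_, ?_, fun j => ?_⟩
    · refine natDegree_add_le_of_degree_le (by simp) (natDegree_mul_le.trans ?_)
      rw [natDegree_X_sub_C]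
      omega
    · have h : g.coeff (n + 1) = 0 := coeff_eq_zero_of_natDegree_lt (by omega)
      simpa [sub_mul, coeff_C, h] using hcoeff
    · refine Fin.cases (by simp) (fun i => ?_) j
      have hi := congrArg (eval (α i.succ)) hdiv
      have he := heval i
      simp only [eval_add, eval_mul] at hi ⊢
      rw [he, hi]

theorem det_vandermonde_nonneg {n : ℕ} {α : Fin n → ℝ} (hα : Monotone α) :
    0 ≤ (Matrix.vandermonde α).det := by
  rw [Matrix.det_vandermonde]
  exact Finset.prod_nonneg fun i _ => Finset.prod_nonneg fun j hj =>
    sub_nonneg.2 (hα (Finset.mem_Ioi.1 hj).le)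

open Polynomial in
/-- Evaluating polynomials `p i` of degree at most `i` at nodes `α j` gives a determinant equal to
the Vandermonde determinant times the product of the coefficients of `X ^ i` in `p i`. -/
theorem det_eval_eq_prod_coeff_mul_det_vandermonde {R : Type*} [CommRing R] {n : ℕ}
    (p : Fin n → R[X]) (hp : ∀ i, (p i).natDegree ≤ i) (α : Fin n → R) :
    (Matrix.of fun i j => (p i).eval (α j)).det =
      (∏ i, (p i).coeff i) * (Matrix.vandermonde α).det := by
  have hmul : (Matrix.of fun i j => (p i).eval (α j)) =
      (Matrix.of fun i l : Fin n => (p i).coeff l) * (Matrix.vandermonde α).transpose := by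
    ext i j
    rw [Matrix.of_apply, eval_eq_sum_range' ((hp i).trans_lt i.2), Matrix.mul_apply,
      ← Fin.sum_univ_eq_sum_range (fun l => (p i).coeff l * α j ^ l)]
    rfl
  rw [hmul, Matrix.det_mul, Matrix.det_transpose, Matrix.det_of_isLowerTriangular]
  · rfl
  · intro i j hij
    exact coeff_eq_zero_of_natDegree_lt ((hp i).trans_lt hij)

/-- The generalized Vandermonde determinant `V_t(α_1,…,α_k)` is nonnegative when
`0 ≤ α_1 ≤ α_2 ≤ … ≤ α_k`. -/
theorem stmt_11 (k t : ℕ) (hk : 1 ≤ k) (α : Fin k → ℝ)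
    (hnonneg : ∀ i, 0 ≤ α i) (hmono : Monotone α) :
    0 ≤ (Matrix.of fun i j : Fin k =>
        if (i : ℕ) = k - 1 then α j ^ (k - 1 + t) else α j ^ (i : ℕ)).det := by
  obtain ⟨n, rfl⟩ := Nat.exists_eq_add_of_le' hk
  obtain ⟨g, hdeg, hcoeff, heval⟩ := exists_interpolant_coeff_nonneg n
    (Polynomial.X ^ (n + t)) (fun i => by rw [Polynomial.coeff_X_pow]; split_ifs <;> simp) α hnonneg
  have h := det_eval_eq_prod_coeff_mul_det_vandermonde
    (fun i : Fin (n + 1) => if (i : ℕ) = n then g else Polynomial.X ^ (i : ℕ))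
    (fun i => by
      split_ifs with hi
      · exact hdeg.trans hi.ge
      · exact Polynomial.natDegree_X_pow_le _) α
  have hM : (Matrix.of fun i j : Fin (n + 1) =>
      if (i : ℕ) = n + 1 - 1 then α j ^ (n + 1 - 1 + t) else α j ^ (i : ℕ)) =
      Matrix.of fun i j : Fin (n + 1) => Polynomial.eval (α j)
        (if (i : ℕ) = n then g else Polynomial.X ^ (i : ℕ)) := by
    ext i j
    simp only [Matrix.of_apply, Nat.add_sub_cancel]
    split_ifs <;> simp [heval]
  rw [hM, h]
  refine mul_nonneg (Finset.prod_nonneg fun i _ => ?_) (det_vandermonde_nonneg hmono)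
  split_ifs with hi
  · rwa [hi]
  · simp
end

section
/- Let k ≥ 1, r ≥ 0, let c, a_1,…,a_k be real numbers, and set α_i = a_i(c−a_i) for 1 ≤ i ≤ k. Then Σ_{t=0}^{⌊r/2⌋} (−1)^t · C(k+r−t, k+t) · c^{r−2t} · h_t(α_1,…,α_k) = Σ_{β_1+…+β_{2k+1} = r, β_i ≥ 0} ( Π_{i=1}^{k} a_i^{β_i} (c−a_i)^{β_{k+i}} ) · c^{β_{2k+1}}. -/
open Finset

section Geometric

open PowerSeries

variable {R : Type*} [CommRing R]

theorem PowerSeries.mk_pow_mul_one_sub (y : R) :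
    (mk fun n => y ^ n) * (1 - C y * X) = 1 := by
  have h := congrArg (rescale y) (mk_one_mul_one_sub_eq_one R)
  simpa [rescale_mk] using h

theorem PowerSeries.coeff_mk_pow_pow_succ (y : R) (d n : ℕ) :
    coeff n ((mk fun m => y ^ m) ^ (d + 1)) = ((d + n).choose d : R) * y ^ n := by
  have h := congrArg (rescale y) (mk_one_pow_eq_mk_choose_add R d)
  have h' := congrArg (coeff n) h
  simpa [rescale_mk, mul_comm] using h'

theorem PowerSeries.coeff_prod_univ_fin {s : ℕ} (f : Fin s → R⟦X⟧) (n : ℕ) :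
    coeff n (∏ i, f i) =
      ∑ β ∈ Finset.Nat.antidiagonalTuple s n, ∏ i, coeff (β i) (f i) := by
  rw [coeff_prod]
  refine Finset.sum_bij' (fun l _ => (l : Fin s → ℕ))
    (fun β _ => Finsupp.equivFunOnFinite.symm β) ?_ ?_ ?_ ?_ ?_ <;>
  simp [Finset.Nat.mem_antidiagonalTuple]

theorem PowerSeries.coeff_subst_mul_eq_sum {b : R⟦X⟧} (hb : X ^ 2 ∣ b) (f g : R⟦X⟧) (r : ℕ) :
    coeff r (f.subst b * g) =
      ∑ t ∈ Finset.range (r / 2 + 1), coeff t f * coeff r (b ^ t * g) := by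
  have hs : HasSubst b := by
    refine HasSubst.of_constantCoeff_zero' ?_
    rw [← X_dvd_iff]
    exact (dvd_pow_self X two_ne_zero).trans hb
  have hdvd : X ^ (r + 1) ∣ b ^ (r / 2 + 1) :=
    (pow_dvd_pow X (by omega)).trans (pow_mul (X : R⟦X⟧) 2 _ ▸ pow_dvd_pow_of_dvd hb _)
  conv_lhs => rw [eq_X_pow_mul_shift_add_trunc (r / 2 + 1) f]
  rw [subst_add hs, subst_mul hs, subst_pow hs, subst_X hs, add_mul, map_add, mul_assoc,
    X_pow_dvd_iff.1 (hdvd.mul_right _) r r.lt_succ_self, zero_add, subst_coe hs,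
    Polynomial.aeval_eq_sum_range' (natDegree_trunc_lt f (r / 2)), Finset.sum_mul, map_sum]
  refine Finset.sum_congr rfl fun t ht => ?_
  rw [smul_mul_assoc, map_smul, coeff_trunc, if_pos (Finset.mem_range.1 ht), smul_eq_mul]

theorem PowerSeries.subst_prod_mk_pow_mul {k : ℕ} (c : R) (a : Fin k → R) :
    (∏ i, mk fun n => (a i * (c - a i)) ^ n : R⟦X⟧).subst
        (-(X ^ 2 * mk fun n => c ^ n) : R⟦X⟧) * (mk fun n => c ^ n) ^ (k + 1) =
      (∏ i, (mk fun n => a i ^ n) * mk fun n => (c - a i) ^ n) * mk fun n => c ^ n := by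
  set G : R⟦X⟧ := mk fun n => c ^ n
  have hs : HasSubst (-(X ^ 2 * G) : R⟦X⟧) := HasSubst.of_constantCoeff_zero' (by simp)
  have hG : G * (1 - C c * X) = 1 := mk_pow_mul_one_sub c
  have key : ∀ i, (mk fun n => (a i * (c - a i)) ^ n : R⟦X⟧).subst (-(X ^ 2 * G) : R⟦X⟧) * G =
      (mk fun n => a i ^ n) * mk fun n => (c - a i) ^ n := by
    intro i
    have h₁ := mk_pow_mul_one_sub (a i)
    have h₂ := mk_pow_mul_one_sub (c - a i)
    have h₃ := congrArg (substAlgHom (R := R) hs) (mk_pow_mul_one_sub (a i * (c - a i)))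
    have hC : substAlgHom (R := R) hs (C (a i * (c - a i))) = C (a i * (c - a i)) :=
      (substAlgHom (R := R) hs).commutes _
    rw [map_mul, map_sub, map_one, map_mul, hC, substAlgHom_X, coe_substAlgHom] at h₃
    simp only [map_mul, map_sub] at h₂ h₃
    generalize (mk fun n => (a i * (c - a i)) ^ n : R⟦X⟧).subst (-(X ^ 2 * G) : R⟦X⟧) = S at *
    generalize (mk fun n => a i ^ n : R⟦X⟧) = A at *
    generalize (mk fun n => (c - a i) ^ n : R⟦X⟧) = B at *
    have hSG : S * G * ((1 - C (a i) * X) * (1 - (C c - C (a i)) * X)) = 1 := by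
      linear_combination h₃ + S * hG
    linear_combination A * B * hSG - S * G * B * (1 - (C c - C (a i)) * X) * h₁ - S * G * h₂
  rw [← coe_substAlgHom hs, map_prod, pow_succ G, ← mul_assoc, ← Fin.prod_const k G,
    ← Finset.prod_mul_distrib]
  simp only [coe_substAlgHom, key]

end Geometric

theorem Fin.prod_univ_of_eq_two_mul_add_one {M : Type*} [CommMonoid M] {k n : ℕ}
    (hn : n = 2 * k + 1) (f : Fin n → M) :
    ∏ j, f j = (∏ i : Fin k, f ⟨(i : ℕ), by omega⟩ * f ⟨k + (i : ℕ), by omega⟩) *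
      f ⟨2 * k, by omega⟩ := by
  subst hn
  rw [Fin.prod_univ_castSucc, ← Fin.prod_congr' _ (two_mul k).symm, Fin.prod_univ_add,
    Finset.prod_mul_distrib]
  rfl

/-- `Σ_{t=0}^{⌊r/2⌋} (-1)^t C(k+r-t,k+t) c^{r-2t} h_t(α_1,…,α_k)` with `α_i = a_i(c-a_i)`
equals the complete homogeneous polynomial `h_r` of the `2k+1` numbers
`a_1,…,a_k, c-a_1,…,c-a_k, c`. -/
theorem stmt_12 (k : ℕ) (hk : 1 ≤ k) (r : ℕ) (c : ℝ) (a : Fin k → ℝ) :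
    ∑ t ∈ Finset.range (r / 2 + 1), (-1 : ℝ) ^ t * ((k + r - t).choose (k + t) : ℝ) *
        c ^ (r - 2 * t) *
        ∑ β ∈ Finset.Nat.antidiagonalTuple k t, ∏ i : Fin k, (a i * (c - a i)) ^ β i =
      ∑ β ∈ Finset.Nat.antidiagonalTuple (2 * k + 1) r,
        (∏ i : Fin k, a i ^ β ⟨(i : ℕ), by omega⟩ *
          (c - a i) ^ β ⟨k + (i : ℕ), by omega⟩) * c ^ β ⟨2 * k, by omega⟩ := by
  let y : Fin (2 * k + 1) → ℝ := fun j =>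
    if h : (j : ℕ) < k then a ⟨j, h⟩
    else if h' : (j : ℕ) - k < k then c - a ⟨j - k, h'⟩ else c
  have y_left (i : Fin k) : y ⟨i, by omega⟩ = a i := by simp [y]
  have y_right (i : Fin k) : y ⟨k + i, by omega⟩ = c - a i := by simp [y]
  have y_last : y ⟨2 * k, by omega⟩ = c := by
    simp only [y]
    rw [dif_neg (by omega), dif_neg (by omega)]
  have hR := PowerSeries.coeff_prod_univ_fin (fun j => PowerSeries.mk fun n => y j ^ n) r
  simp only [Fin.prod_univ_of_eq_two_mul_add_one rfl, y_left, y_right, y_last, PowerSeries.coeff_mk] at hR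
  rw [← hR, ← PowerSeries.subst_prod_mk_pow_mul,
    PowerSeries.coeff_subst_mul_eq_sum ((dvd_mul_right _ _).neg_right)]
  refine Finset.sum_congr rfl fun t ht => ?_
  have ht' : 2 * t ≤ r := by
    have := Finset.mem_range.1 ht
    omega
  rw [PowerSeries.coeff_prod_univ_fin, neg_pow (_ * _), mul_pow (_ ^ 2), ← pow_mul, mul_assoc (_ ^ t) (_ * _),
    mul_assoc (_ ^ (2 * t)), ← pow_add, show t + (k + 1) = k + t + 1 by omega,
    show ((-1 : PowerSeries ℝ) ^ t) = PowerSeries.C ((-1 : ℝ) ^ t) by simp,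
    PowerSeries.coeff_C_mul, PowerSeries.coeff_X_pow_mul', if_pos ht',
    PowerSeries.coeff_mk_pow_pow_succ, show k + t + (r - 2 * t) = k + r - t by omega]
  simp only [PowerSeries.coeff_mk]
  ring
end

section
/- Let k ≥ 1, r ≥ 0, let c, a_1,…,a_k be real numbers, and set α_i = a_i(c−a_i) for 1 ≤ i ≤ k. Then Σ_{t=0}^{⌊r/2⌋} (−1)^t · [ C(k+r−t, k+t) + C(k+r−t−1, k+t−1) ] · c^{r−2t} · h_t(α_1,…,α_k) = Σ_{β_1+…+β_{2k} = r, β_i ≥ 0} ( Π_{i=1}^{k−1} a_i^{β_i} (c−a_i)^{β_{k+i}} ) · c^{β_{2k}} · ( a_k^{β_k} + (c−a_k)^{β_k} ). -/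
open Finset

/-- The geometric series `∑ aⁿ Xⁿ`. -/
noncomputable def geomSeries (a : ℝ) : PowerSeries ℝ := PowerSeries.mk fun n => a ^ n

theorem geomSeries_mul_one_sub (a : ℝ) :
    geomSeries a * (1 - PowerSeries.C a * PowerSeries.X) = 1 := by
  have h := congrArg (PowerSeries.rescale a) (PowerSeries.mk_one_mul_one_sub_eq_one ℝ)
  simpa [geomSeries, PowerSeries.rescale_mk, PowerSeries.rescale_X] using h

theorem coeff_geomSeries_pow_succ (a : ℝ) (d n : ℕ) :
    PowerSeries.coeff n (geomSeries a ^ (d + 1)) = ((d + n).choose d : ℝ) * a ^ n := by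
  have h := congrArg (PowerSeries.rescale a) (PowerSeries.mk_one_pow_eq_mk_choose_add ℝ d)
  rw [map_pow] at h
  have e : PowerSeries.rescale a (PowerSeries.mk 1) = geomSeries a := by
    simp [geomSeries, PowerSeries.rescale_mk]
  rw [e] at h
  rw [h, PowerSeries.rescale_mk, PowerSeries.coeff_mk, mul_comm]

theorem coeff_prod_mk_eq_sum_antidiagonalTuple (n r : ℕ) (f : Fin n → ℕ → ℝ) :
    PowerSeries.coeff r (∏ i, PowerSeries.mk (f i)) =
      ∑ β ∈ Finset.Nat.antidiagonalTuple n r, ∏ i, f i (β i) := by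
  rw [PowerSeries.coeff_prod]
  refine Finset.sum_bij' (fun l _ => (l : Fin n → ℕ))
    (fun β _ => Finsupp.equivFunOnFinite.symm β) ?_ ?_ ?_ ?_ ?_ <;>
  simp [Finset.mem_finsuppAntidiag, Finset.Nat.mem_antidiagonalTuple]

theorem prod_fin_two_mul_succ {M : Type*} [CommMonoid M] (m : ℕ) (g : Fin (2 * (m + 1)) → M) :
    ∏ j, g j = (∏ i : Fin m, g ⟨i, by omega⟩ * g ⟨m + 1 + i, by omega⟩) *
      g ⟨m, by omega⟩ * g ⟨2 * m + 1, by omega⟩ := by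
  rw [← Fin.prod_congr' g (show (m + 1) + (m + 1) = 2 * (m + 1) by ring), Fin.prod_univ_add,
    Fin.prod_univ_castSucc, Fin.prod_univ_castSucc, Finset.prod_mul_distrib]
  have e : (⟨2 * m + 1, by omega⟩ : Fin (2 * (m + 1))) =
      Fin.cast (by ring) (Fin.natAdd (m + 1) (Fin.last m)) := by
    ext; simp; ring
  rw [e]
  exact mul_mul_mul_comm _ _ _ _ |>.trans (mul_assoc _ _ _).symm

/-- The series `-X² / (1 - cX)`. -/
noncomputable def negSqGeom (c : ℝ) : PowerSeries ℝ := -(PowerSeries.X ^ 2 * geomSeries c)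

theorem hasSubst_negSqGeom (c : ℝ) : PowerSeries.HasSubst (negSqGeom c) :=
  PowerSeries.HasSubst.of_constantCoeff_zero' (by simp [negSqGeom])

theorem substAlgHom_geomSeries_mul (c a : ℝ) :
    PowerSeries.substAlgHom (R := ℝ) (hasSubst_negSqGeom c) (geomSeries a) *
      (1 - PowerSeries.C a * negSqGeom c) = 1 := by
  have h := congrArg (PowerSeries.substAlgHom (R := ℝ) (hasSubst_negSqGeom c))
    (geomSeries_mul_one_sub a)
  rw [map_mul, map_sub, map_mul, map_one, PowerSeries.substAlgHom_X] at h
  have e : PowerSeries.substAlgHom (R := ℝ) (hasSubst_negSqGeom c) (PowerSeries.C a) =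
      PowerSeries.C a :=
    (PowerSeries.substAlgHom (R := ℝ) (hasSubst_negSqGeom c)).commutes a
  rwa [e] at h

theorem geomSeries_mul_geomSeries_sub (c a : ℝ) :
    geomSeries a * geomSeries (c - a) = geomSeries c *
      PowerSeries.substAlgHom (R := ℝ) (hasSubst_negSqGeom c) (geomSeries (a * (c - a))) := by
  have h1 := geomSeries_mul_one_sub a
  have h2 := geomSeries_mul_one_sub (c - a)
  have h3 := geomSeries_mul_one_sub c
  have h4 := substAlgHom_geomSeries_mul c (a * (c - a))
  set S := PowerSeries.substAlgHom (R := ℝ) (hasSubst_negSqGeom c) (geomSeries (a * (c - a)))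
  rw [negSqGeom] at h4
  simp only [map_sub, map_mul] at h2 h4
  set A := geomSeries a
  set B := geomSeries (c - a)
  set u := geomSeries c
  set x : PowerSeries ℝ := PowerSeries.X
  set p := PowerSeries.C (R := ℝ) a
  set q := PowerSeries.C (R := ℝ) c
  have h5 : u * S * ((1 - p * x) * (1 - (q - p) * x)) = 1 := by
    linear_combination h4 + S * h3
  calc A * B = A * B * (u * S * ((1 - p * x) * (1 - (q - p) * x))) := by rw [h5, mul_one]
    _ = u * S * ((A * (1 - p * x)) * (B * (1 - (q - p) * x))) := by ring
    _ = u * S := by rw [h1, h2, one_mul, mul_one]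

theorem geomSeries_mul_geomSeries_add (c a : ℝ) :
    (geomSeries a + geomSeries (c - a)) * geomSeries c =
      geomSeries a * geomSeries (c - a) * (geomSeries c + 1) := by
  have h1 := geomSeries_mul_one_sub a
  have h2 := geomSeries_mul_one_sub (c - a)
  have h3 := geomSeries_mul_one_sub c
  simp only [map_sub] at h2
  linear_combination (-geomSeries (c - a) * geomSeries c) * h1 -
    geomSeries a * geomSeries c * h2 + geomSeries a * geomSeries (c - a) * h3

theorem prod_geomSeries_eq (m : ℕ) (c : ℝ) (a : Fin (m + 1) → ℝ) :
    (∏ i : Fin m, geomSeries (a i.castSucc) * geomSeries (c - a i.castSucc)) *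
        (geomSeries (a (Fin.last m)) + geomSeries (c - a (Fin.last m))) * geomSeries c =
      geomSeries c ^ (m + 1) * (geomSeries c + 1) *
        PowerSeries.substAlgHom (R := ℝ) (hasSubst_negSqGeom c)
          (∏ i, geomSeries (a i * (c - a i))) := by
  rw [mul_assoc, geomSeries_mul_geomSeries_add, ← mul_assoc,
    ← Fin.prod_univ_castSucc (fun i => geomSeries (a i) * geomSeries (c - a i))]
  simp only [geomSeries_mul_geomSeries_sub, Finset.prod_mul_distrib, map_prod]
  simp
  ring

theorem substAlgHom_eq_sum_add (c : ℝ) (H : PowerSeries ℝ) (N : ℕ) :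
    ∃ G, PowerSeries.substAlgHom (R := ℝ) (hasSubst_negSqGeom c) H =
      ∑ t ∈ Finset.range N, PowerSeries.C (PowerSeries.coeff t H) * negSqGeom c ^ t +
        negSqGeom c ^ N * G := by
  refine ⟨PowerSeries.substAlgHom (R := ℝ) (hasSubst_negSqGeom c)
    (PowerSeries.mk fun i ↦ PowerSeries.coeff (i + N) H), ?_⟩
  conv_lhs => rw [PowerSeries.eq_X_pow_mul_shift_add_trunc N H]
  rw [map_add, map_mul, map_pow, PowerSeries.substAlgHom_X, add_comm,
    PowerSeries.substAlgHom_coe]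
  congr 1
  rw [PowerSeries.trunc_apply, Nat.Ico_zero_eq_range, map_sum]
  refine Finset.sum_congr rfl fun t _ => ?_
  rw [Polynomial.aeval_monomial]
  rfl

theorem coeff_geomSeries_mul_negSqGeom_pow (m r t : ℕ) (ht : 2 * t ≤ r) (c : ℝ) :
    PowerSeries.coeff r (geomSeries c ^ (m + 1) * (geomSeries c + 1) * negSqGeom c ^ t) =
      (-1) ^ t * (((m + 1 + r - t).choose (m + 1 + t) : ℝ) +
        ((m + 1 + r - t - 1).choose (m + 1 + t - 1) : ℝ)) * c ^ (r - 2 * t) := by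
  have e : geomSeries c ^ (m + 1) * (geomSeries c + 1) * negSqGeom c ^ t =
      PowerSeries.C ((-1) ^ t) * (PowerSeries.X ^ (2 * t) *
        (geomSeries c ^ (m + 1 + t + 1) + geomSeries c ^ (m + t + 1))) := by
    rw [negSqGeom, neg_pow, map_pow, map_neg, map_one]
    ring
  obtain ⟨n, rfl⟩ := Nat.exists_eq_add_of_le ht
  rw [e, PowerSeries.coeff_C_mul, PowerSeries.coeff_X_pow_mul', if_pos ht, map_add,
    coeff_geomSeries_pow_succ, coeff_geomSeries_pow_succ,
    show m + 1 + (2 * t + n) - t - 1 = m + t + n by omega,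
    show m + 1 + (2 * t + n) - t = m + 1 + t + n by omega,
    show m + 1 + t - 1 = m + t by omega, show 2 * t + n - 2 * t = n by omega]
  ring

theorem coeff_mul_negSqGeom_pow_of_lt (c : ℝ) (F G : PowerSeries ℝ) {r N : ℕ} (h : r < 2 * N) :
    PowerSeries.coeff r (F * (negSqGeom c ^ N * G)) = 0 := by
  have e : F * (negSqGeom c ^ N * G) =
      PowerSeries.X ^ (2 * N) * (F * G * (-1) ^ N * geomSeries c ^ N) := by
    rw [negSqGeom, neg_pow]
    ring
  rw [e, PowerSeries.coeff_X_pow_mul', if_neg (by omega)]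

/-- `Σ_{t=0}^{⌊r/2⌋} (-1)^t [C(k+r-t,k+t) + C(k+r-t-1,k+t-1)] c^{r-2t} h_t(α_1,…,α_k)`
with `α_i = a_i(c-a_i)` equals
`Σ_{β_1+…+β_{2k}=r} (Π_{i=1}^{k-1} a_i^{β_i}(c-a_i)^{β_{k+i}}) c^{β_{2k}}
  (a_k^{β_k} + (c-a_k)^{β_k})`. -/
theorem stmt_14 (k : ℕ) (hk : 1 ≤ k) (r : ℕ) (c : ℝ) (a : Fin k → ℝ) :
    ∑ t ∈ Finset.range (r / 2 + 1), (-1 : ℝ) ^ t *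
        (((k + r - t).choose (k + t) : ℝ) + ((k + r - t - 1).choose (k + t - 1) : ℝ)) *
        c ^ (r - 2 * t) *
        ∑ β ∈ Finset.Nat.antidiagonalTuple k t, ∏ i : Fin k, (a i * (c - a i)) ^ β i =
      ∑ β ∈ Finset.Nat.antidiagonalTuple (2 * k) r,
        (∏ i : Fin (k - 1), a ⟨(i : ℕ), by omega⟩ ^ β ⟨(i : ℕ), by omega⟩ *
            (c - a ⟨(i : ℕ), by omega⟩) ^ β ⟨k + (i : ℕ), by omega⟩) *
          c ^ β ⟨2 * k - 1, by omega⟩ *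
          (a ⟨k - 1, by omega⟩ ^ β ⟨k - 1, by omega⟩ +
            (c - a ⟨k - 1, by omega⟩) ^ β ⟨k - 1, by omega⟩) := by
  obtain ⟨m, rfl⟩ : ∃ m, k = m + 1 := ⟨k - 1, by omega⟩
  let f : Fin (2 * (m + 1)) → ℕ → ℝ := fun j n =>
    if h : (j : ℕ) < m then a ⟨j, by omega⟩ ^ n
    else if (j : ℕ) = m then a (Fin.last m) ^ n + (c - a (Fin.last m)) ^ n
    else if h' : (j : ℕ) < 2 * m + 1 then (c - a ⟨j - (m + 1), by omega⟩) ^ n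
    else c ^ n
  have f_left (i : Fin m) : f ⟨i, by omega⟩ = fun n => a i.castSucc ^ n := by
    funext n
    simp only [f, i.isLt, dite_true]
    rfl
  have f_right (i : Fin m) : f ⟨m + 1 + i, by omega⟩ = fun n => (c - a i.castSucc) ^ n := by
    funext n
    have h1 : ¬ (m + 1 + (i : ℕ) < m) := by omega
    have h2 : ¬ (m + 1 + (i : ℕ) = m) := by omega
    have h3 : m + 1 + (i : ℕ) < 2 * m + 1 := by omega
    simp only [f, h1, h2, h3, dite_true, dite_false, if_false, Nat.add_sub_cancel_left]
    rfl
  have f_mid : f ⟨m, by omega⟩ =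
      fun n => a (Fin.last m) ^ n + (c - a (Fin.last m)) ^ n := by
    funext n
    simp [f]
  have f_last : f ⟨2 * m + 1, by omega⟩ = fun n => c ^ n := by
    funext n
    have h1 : ¬ (2 * m + 1 < m) := by omega
    have h2 : ¬ (2 * m + 1 = m) := by omega
    simp [f, h1, h2]
  have rhs := coeff_prod_mk_eq_sum_antidiagonalTuple (2 * (m + 1)) r f
  have mid_eq : PowerSeries.mk (fun n => a (Fin.last m) ^ n + (c - a (Fin.last m)) ^ n) =
      geomSeries (a (Fin.last m)) + geomSeries (c - a (Fin.last m)) := by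
    ext n
    simp [geomSeries]
  have mk_pow_eq (x : ℝ) : PowerSeries.mk (fun n => x ^ n) = geomSeries x := rfl
  simp only [prod_fin_two_mul_succ, f_left, f_right, f_mid, f_last, mid_eq,
    mk_pow_eq] at rhs
  obtain ⟨G, hG⟩ := substAlgHom_eq_sum_add c (∏ i, geomSeries (a i * (c - a i))) (r / 2 + 1)
  rw [prod_geomSeries_eq, hG, mul_add, map_add,
    coeff_mul_negSqGeom_pow_of_lt c _ _ (by omega), add_zero, Finset.mul_sum, map_sum] at rhs
  refine Eq.trans (Finset.sum_congr rfl fun t ht => ?_)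
    (rhs.trans (Finset.sum_congr rfl fun β _ => mul_right_comm _ _ _))
  rw [mul_left_comm, PowerSeries.coeff_C_mul, coeff_geomSeries_mul_negSqGeom_pow m r t
    (by have := Finset.mem_range.mp ht; omega), mul_comm]
  congr 1
  exact (coeff_prod_mk_eq_sum_antidiagonalTuple (m + 1) t
    fun i n => (a i * (c - a i)) ^ n).symm
end

section
/- Let s ≥ 1 and l ≥ 0 be integers and let d_1,…,d_s be elements of a commutative ring R. Then f_l(d_1,…,d_s) = Σ_{r=0}^{l} (−1)^{l−r} · e_{l−r}(1, 2, …, s+l−1) · h_r(d_1,…,d_s), where the integers 1,…,s+l−1 are interpreted as elements of R. -/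
open Finset

/-- `f_l(y_1,…,y_s) = Σ_{1 ≤ i_1 ≤ … ≤ i_l ≤ s} Π_{t=1}^l (y_{i_t} - (i_t + t - 1))`,
indexed here by monotone tuples `i : Fin l → Fin s` (0-based), so the subtracted
constant is `(i_t + 1) + (t + 1) - 1 = i_t + t + 1`. -/
noncomputable def fP (R : Type*) [CommRing R] (s l : ℕ) (y : Fin s → R) : R :=
  ∑ i ∈ Finset.univ.filter (fun i : Fin l → Fin s => Monotone i),
    ∏ t : Fin l, (y (i t) - (((i t : ℕ) + (t : ℕ) + 1 : ℕ) : R))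

/-- Splitting monotone tuples according to whether the last entry is the maximal index. -/
theorem fP_succ_succ (R : Type*) [CommRing R] (s l : ℕ) (y : Fin (s + 1) → R) :
    fP R (s + 1) (l + 1) y =
      fP R s (l + 1) (fun j => y j.castSucc) +
        fP R (s + 1) l y * (y (Fin.last s) - ((s + l + 1 : ℕ) : R)) := by
  unfold fP
  rw [← Finset.sum_filter_not_add_sum_filter _ (fun i => i (Fin.last l) = Fin.last s)]
  congr 1
  · symm
    refine Finset.sum_bij (fun i _ t => (i t).castSucc) ?_ ?_ ?_ ?_
    · intro i hi
      simp only [mem_filter, mem_univ, true_and] at hi ⊢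
      exact ⟨fun a b hab => Fin.castSucc_le_castSucc_iff.2 (hi hab), (Fin.castSucc_lt_last _).ne⟩
    · intro i _ j _ h
      funext t
      exact Fin.castSucc_injective _ (congrFun h t)
    · intro i hi
      simp only [mem_filter, mem_univ, true_and] at hi
      have hne : ∀ t, i t ≠ Fin.last s := fun t =>
        ((hi.1 (Fin.le_last t)).trans_lt (Fin.lt_last_iff_ne_last.2 hi.2)).ne
      refine ⟨fun t => (i t).castPred (hne t), ?_, by funext t; simp⟩
      simp only [mem_filter, mem_univ, true_and]
      exact fun a b hab => by simpa using hi.1 hab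
    · intro i _
      simp
  · rw [Finset.sum_mul]
    symm
    refine Finset.sum_bij (fun i _ => (Fin.snoc i (Fin.last s) : Fin (l + 1) → Fin (s + 1)))
      ?_ ?_ ?_ ?_
    · intro i hi
      simp only [mem_filter, mem_univ, true_and] at hi ⊢
      refine ⟨fun a b => ?_, by simp⟩
      induction b using Fin.lastCases with
      | last => intro _; simpa using Fin.le_last _
      | cast b =>
        induction a using Fin.lastCases with
        | last => intro h; exact absurd h (Fin.castSucc_lt_last b).not_ge
        | cast a => intro h; simpa using hi (Fin.castSucc_le_castSucc_iff.1 h)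
    · intro i _ j _ h
      exact (Fin.snoc_injective2 h).1
    · intro i hi
      simp only [mem_filter, mem_univ, true_and] at hi
      refine ⟨fun t => i t.castSucc, ?_, ?_⟩
      · simp only [mem_filter, mem_univ, true_and]
        exact fun a b hab => hi.1 (Fin.castSucc_le_castSucc_iff.2 hab)
      · rw [← hi.2]
        exact Fin.snoc_init_self i
    · intro i _
      simp [Fin.prod_univ_castSucc]

theorem fP_zero_right (R : Type*) [CommRing R] (s : ℕ) (y : Fin s → R) : fP R s 0 y = 1 := by
  have h : ∀ i : Fin 0 → Fin s, Monotone i := fun _ a => a.elim0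
  simp [fP, h]

theorem fP_zero_succ (R : Type*) [CommRing R] (l : ℕ) (y : Fin 0 → R) :
    fP R 0 (l + 1) y = 0 := by
  simp [fP]

/-- Splitting exponent vectors according to whether the last variable occurs. -/
theorem sum_antidiagonalTuple_succ_succ {R : Type*} [CommRing R] (s r : ℕ)
    (d : Fin (s + 1) → R) :
    ∑ β ∈ Finset.Nat.antidiagonalTuple (s + 1) (r + 1), ∏ i, d i ^ β i =
      ∑ β ∈ Finset.Nat.antidiagonalTuple s (r + 1), ∏ i : Fin s, d i.castSucc ^ β i +
        d (Fin.last s) *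
          ∑ β ∈ Finset.Nat.antidiagonalTuple (s + 1) r, ∏ i, d i ^ β i := by
  rw [← Finset.sum_filter_add_sum_filter_not _ (fun β => β (Fin.last s) = 0)]
  congr 1
  · symm
    refine Finset.sum_bij (fun β _ => (Fin.snoc β 0 : Fin (s + 1) → ℕ)) ?_ ?_ ?_ ?_
    · intro β hβ
      rw [Finset.Nat.mem_antidiagonalTuple] at hβ
      simp [Finset.Nat.mem_antidiagonalTuple, Fin.sum_univ_castSucc, hβ]
    · intro β _ γ _ h
      exact (Fin.snoc_injective2 h).1
    · intro β hβ
      simp only [mem_filter, Finset.Nat.mem_antidiagonalTuple, Fin.sum_univ_castSucc] at hβ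
      refine ⟨fun t => β t.castSucc, ?_, ?_⟩
      · rw [Finset.Nat.mem_antidiagonalTuple]
        simpa [hβ.2] using hβ.1
      · rw [← hβ.2]
        exact Fin.snoc_init_self β
    · intro β _
      simp [Fin.prod_univ_castSucc]
  · rw [Finset.mul_sum]
    symm
    refine Finset.sum_bij (fun β _ => β + Pi.single (Fin.last s) 1) ?_ ?_ ?_ ?_
    · intro β hβ
      rw [Finset.Nat.mem_antidiagonalTuple] at hβ
      simp [Finset.Nat.mem_antidiagonalTuple, Finset.sum_add_distrib, hβ]
    · intro β _ γ _ h
      exact add_right_cancel h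
    · intro β hβ
      simp only [mem_filter, Finset.Nat.mem_antidiagonalTuple] at hβ
      have hle : Pi.single (Fin.last s) 1 ≤ β := by
        intro t
        rcases eq_or_ne t (Fin.last s) with rfl | ht
        · simpa using Nat.one_le_iff_ne_zero.2 hβ.2
        · simp [ht]
      have hsub := tsub_add_cancel_of_le hle
      refine ⟨β - Pi.single (Fin.last s) 1, ?_, hsub⟩
      rw [Finset.Nat.mem_antidiagonalTuple]
      have := hβ.1
      rw [← hsub] at this
      simpa [Finset.sum_add_distrib, -Pi.sub_apply] using this
    · intro β _
      simp [Fin.prod_univ_castSucc, pow_succ]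
      ring

theorem sum_antidiagonalTuple_zero {R : Type*} [CommRing R] (s : ℕ) (d : Fin s → R) :
    ∑ β ∈ Finset.Nat.antidiagonalTuple s 0, ∏ i, d i ^ β i = 1 := by
  simp [Finset.Nat.antidiagonalTuple_zero_right]

theorem sum_powersetCard_Icc_succ {R : Type*} [CommRing R] (N k : ℕ) :
    ∑ S ∈ powersetCard (k + 1) (Icc 1 (N + 1)), ∏ x ∈ S, (x : R) =
      ∑ S ∈ powersetCard (k + 1) (Icc 1 N), ∏ x ∈ S, (x : R) +
        ((N + 1 : ℕ) : R) * ∑ S ∈ powersetCard k (Icc 1 N), ∏ x ∈ S, (x : R) := by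
  have hN : N + 1 ∉ Icc 1 N := by simp
  have hS : ∀ S ∈ powersetCard k (Icc 1 N), N + 1 ∉ S := fun S h h' =>
    hN ((mem_powersetCard.1 h).1 h')
  rw [← Finset.insert_Icc_right_eq_Icc_add_one (by lia : 1 ≤ N + 1), powersetCard_succ_insert hN,
    sum_union, sum_image, mul_sum]
  · congr 1
    exact sum_congr rfl fun S h => prod_insert (hS S h)
  · intro S h T h' hST
    rw [← erase_insert (hS S h), ← erase_insert (hS T h'), hST]
  · rw [disjoint_left]
    intro S h h'
    obtain ⟨T, -, rfl⟩ := mem_image.1 h'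
    exact hN ((mem_powersetCard.1 h).1 (mem_insert_self _ _))

/-- The recursion shared by convolutions of elementary and complete symmetric sums. -/
theorem sum_convolution_succ {R : Type*} [CommRing R] (l : ℕ) (c x : R) (e e' h h' : ℕ → R)
    (he0 : e' 0 = e 0) (he : ∀ k, e' (k + 1) = e (k + 1) + c * e k)
    (hh0 : h' 0 = h 0) (hh : ∀ r, h' (r + 1) = h (r + 1) + x * h' r) :
    ∑ r ∈ range (l + 1 + 1), (-1) ^ (l + 1 - r) * e' (l + 1 - r) * h' r =
      ∑ r ∈ range (l + 1 + 1), (-1) ^ (l + 1 - r) * e (l + 1 - r) * h r +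
        (∑ r ∈ range (l + 1), (-1) ^ (l - r) * e (l - r) * h' r) * (x - c) := by
  have h1 : ∑ r ∈ range (l + 1 + 1), (-1) ^ (l + 1 - r) * e' (l + 1 - r) * h' r =
      ∑ r ∈ range (l + 1 + 1), (-1) ^ (l + 1 - r) * e (l + 1 - r) * h' r -
        c * ∑ r ∈ range (l + 1), (-1) ^ (l - r) * e (l - r) * h' r := by
    rw [sum_range_succ, sum_range_succ _ (l + 1), add_sub_right_comm, mul_sum, ← sum_sub_distrib]
    congr 1
    · refine sum_congr rfl fun r hr => ?_
      rw [Nat.succ_sub (mem_range_succ_iff.1 hr), he, pow_succ]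
      ring
    · simp [he0]
  have h2 : ∑ r ∈ range (l + 1 + 1), (-1) ^ (l + 1 - r) * e (l + 1 - r) * h' r =
      ∑ r ∈ range (l + 1 + 1), (-1) ^ (l + 1 - r) * e (l + 1 - r) * h r +
        x * ∑ r ∈ range (l + 1), (-1) ^ (l - r) * e (l - r) * h' r := by
    rw [sum_range_succ', sum_range_succ' _ (l + 1), add_right_comm, mul_sum, ← sum_add_distrib, hh0]
    congr 1
    refine sum_congr rfl fun r _ => ?_
    rw [Nat.add_sub_add_right, hh]
    ring
  rw [h1, h2]
  ring

/-- The expansion of `fP` in complete homogeneous sums, valid also without variables. -/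
theorem fP_eq_sum (R : Type*) [CommRing R] (s l : ℕ) (d : Fin s → R) :
    fP R s l d =
      ∑ r ∈ range (l + 1), (-1 : R) ^ (l - r) *
        (∑ S ∈ powersetCard (l - r) (Icc 1 (s + l - 1)), ∏ x ∈ S, (x : R)) *
        ∑ β ∈ Finset.Nat.antidiagonalTuple s r, ∏ i : Fin s, d i ^ β i := by
  induction s generalizing l with
  | zero =>
    cases l with
    | zero => simp [fP_zero_right]
    | succ l =>
      rw [fP_zero_succ, sum_range_succ', powersetCard_eq_empty.2 (by simp)]
      simp
  | succ s ihs =>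
    induction l with
    | zero => simp [fP_zero_right, sum_antidiagonalTuple_zero]
    | succ l ihl =>
      rw [fP_succ_succ, ihs, ihl]
      have hN : s + 1 + (l + 1) - 1 = s + l + 1 := by lia
      have hN' : s + 1 + l - 1 = s + l := by lia
      have hN'' : s + (l + 1) - 1 = s + l := by lia
      rw [hN, hN', hN'']
      exact (sum_convolution_succ l ((s + l + 1 : ℕ) : R) (d (Fin.last s))
        (fun k => ∑ S ∈ powersetCard k (Icc 1 (s + l)), ∏ x ∈ S, (x : R))
        (fun k => ∑ S ∈ powersetCard k (Icc 1 (s + l + 1)), ∏ x ∈ S, (x : R))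
        (fun r => ∑ β ∈ Finset.Nat.antidiagonalTuple s r, ∏ i : Fin s, d i.castSucc ^ β i)
        (fun r => ∑ β ∈ Finset.Nat.antidiagonalTuple (s + 1) r, ∏ i, d i ^ β i)
        (by simp) (sum_powersetCard_Icc_succ (s + l))
        (by simp only [sum_antidiagonalTuple_zero])
        (fun r => sum_antidiagonalTuple_succ_succ s r d)).symm

/-- `f_l(d_1,…,d_s) = Σ_{r=0}^l (-1)^{l-r} e_{l-r}(1,…,s+l-1) h_r(d_1,…,d_s)`. -/
theorem stmt_15 (R : Type*) [CommRing R] (s l : ℕ) (hs : 1 ≤ s) (d : Fin s → R) :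
    fP R s l d =
      ∑ r ∈ Finset.range (l + 1), (-1 : R) ^ (l - r) *
        (∑ S ∈ Finset.powersetCard (l - r) (Finset.Icc 1 (s + l - 1)), ∏ x ∈ S, (x : R)) *
        ∑ β ∈ Finset.Nat.antidiagonalTuple s r, ∏ i : Fin s, d i ^ β i := by
  exact fP_eq_sum R s l d
end
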